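/- arXiv:1103.1237 — 2 statements merged into one kernel-verified Lean document; each statement's English description precedes it below -/
import Mathlib

section
/- Let N ≥ 2, p > 1 and m > 0. There exists a constant c₀ > 0, depending only on N, p and m, with the following property: whenever h : EuclideanSpace ℝ (Fin N) → ℝ is nonnegative and bounded on the annulus Ω = {x : 1/2 < ‖x‖ < 3}, A ⊆ Ω is a measurable set with volume(A) ≥ m, and u ≥ 0 is a classical supersolution of −Δ_p u ≥ h on Ω, then inf { u(x) : 1 ≤ ‖x‖ ≤ 2 } ≥ c₀ · (sInf (h '' A))^(1/(p−1)). -/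
open MeasureTheory Filter Real Matrix
open scoped RealInnerProductSpace

/-- The vector field `F_p u (x) = ‖∇u(x)‖^(p-2) • ∇u(x)` (real power; equal to `0`
when `∇u(x) = 0`). -/
noncomputable def pFlux (N : ℕ) (p : ℝ) (u : EuclideanSpace ℝ (Fin N) → ℝ)
    (x : EuclideanSpace ℝ (Fin N)) : EuclideanSpace ℝ (Fin N) :=
  ‖gradient u x‖ ^ (p - 2) • gradient u x

/-- The `p`-Laplacian `Δ_p u (x) = div (F_p u) (x)`. -/
noncomputable def pLaplacian (N : ℕ) (p : ℝ) (u : EuclideanSpace ℝ (Fin N) → ℝ)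
    (x : EuclideanSpace ℝ (Fin N)) : ℝ :=
  ∑ i : Fin N, ⟪fderiv ℝ (pFlux N p u) x (EuclideanSpace.basisFun (Fin N) ℝ i),
      EuclideanSpace.basisFun (Fin N) ℝ i⟫

/-- `u` is a classical supersolution of `-Δ_p u ≥ g` on `Ω`. -/
def IsPSupersolution (N : ℕ) (p : ℝ) (u : EuclideanSpace ℝ (Fin N) → ℝ)
    (g : EuclideanSpace ℝ (Fin N) → ℝ) (Ω : Set (EuclideanSpace ℝ (Fin N))) : Prop :=
  ContDiffOn ℝ 1 u Ω ∧ DifferentiableOn ℝ (pFlux N p u) Ω ∧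
    ∀ x ∈ Ω, -pLaplacian N p u x ≥ g x

open Topology

/-- If a compactly supported differentiable vector field has divergence bounded above by an
integrable function, then that function has nonnegative integral. -/
lemma integral_nonneg_of_divergence_le_pi {n : ℕ} {f : (Fin (n + 1) → ℝ) → Fin (n + 1) → ℝ}
    (hf : Differentiable ℝ f) (hc : HasCompactSupport f) {G : (Fin (n + 1) → ℝ) → ℝ}
    (hG : Integrable G) (hle : ∀ x, ∑ i, fderiv ℝ f x (Pi.single i 1) i ≤ G x) :
    0 ≤ ∫ x, G x := by
  obtain ⟨r, hr0, hr⟩ : ∃ r : ℝ, 0 < r ∧ ∀ x, r ≤ ‖x‖ → x ∉ tsupport f := by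
    obtain ⟨r, hr⟩ := hc.isCompact.isBounded.exists_norm_le
    refine ⟨max r 0 + 1, by positivity, fun x hx hmem => ?_⟩
    have := hr x hmem
    linarith [le_max_left r 0]
  let I : BoxIntegral.Box (Fin (n + 1)) := ⟨fun _ => -r, fun _ => r, fun _ => by linarith⟩
  have h0 : ∀ x : Fin (n + 1) → ℝ, r ≤ ‖x‖ → f x = 0 := fun x hx =>
    image_eq_zero_of_notMem_tsupport (hr x hx)
  have hcoord : ∀ (x : Fin (n + 1) → ℝ) (i : Fin (n + 1)), r ≤ |x i| → r ≤ ‖x‖ := fun x i hi =>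
    hi.trans (norm_le_pi_norm x i)
  have hB := BoxIntegral.hasIntegral_GP_divergence_of_forall_hasDerivWithinAt I f (fderiv ℝ f) ∅
    Set.countable_empty (by simp) (fun x _ => (hf x).hasFDerivAt.hasFDerivWithinAt)
  have hz : (∑ i, (BoxIntegral.integral (I.face i) BoxIntegral.IntegrationParams.GP
        (fun x => f (i.insertNth (I.upper i) x) i) BoxIntegral.BoxAdditiveMap.volume -
      BoxIntegral.integral (I.face i) BoxIntegral.IntegrationParams.GP
        (fun x => f (i.insertNth (I.lower i) x) i) BoxIntegral.BoxAdditiveMap.volume)) = 0 := by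
    refine Finset.sum_eq_zero fun i _ => ?_
    have h1 : (fun x => f (i.insertNth (I.upper i) x) i) = fun _ => 0 := by
      funext x
      rw [h0 _ (hcoord _ i (by simp [I, le_abs_self]))]
      rfl
    have h2 : (fun x => f (i.insertNth (I.lower i) x) i) = fun _ => 0 := by
      funext x
      rw [h0 _ (hcoord _ i (by simp [I, le_abs_self]))]
      rfl
    rw [h1, h2]
    simp
  rw [hz] at hB
  have hA := (hG.integrableOn (s := (I : Set (Fin (n + 1) → ℝ)))).hasBoxIntegral ⊥ rfl
  have hsub := hA.sub hB
  have hI : 0 ≤ ∫ x in (I : Set (Fin (n + 1) → ℝ)), G x := by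
    have := BoxIntegral.integral_nonneg (I := I) (l := ⊥)
      (g := fun x => G x - ∑ i, fderiv ℝ f x (Pi.single i 1) i)
      (fun x _ => by simpa using hle x) volume
    have h3 := hsub.integral_eq
    rw [sub_zero] at h3
    rw [← h3]
    exact this
  have hIc : 0 ≤ ∫ x in (I : Set (Fin (n + 1) → ℝ))ᶜ, G x := by
    refine setIntegral_nonneg I.measurableSet_coe.compl fun x hx => ?_
    refine le_trans (le_of_eq ?_) (hle x)
    have hx' : r ≤ ‖x‖ := by
      by_contra hlt
      push Not at hlt
      refine hx ?_
      rw [BoxIntegral.Box.mem_coe, BoxIntegral.Box.mem_def]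
      intro i
      have h4 := abs_lt.1 ((norm_le_pi_norm x i).trans_lt hlt)
      exact ⟨h4.1, h4.2.le⟩
    have h5 : fderiv ℝ f x = 0 := by
      have : x ∉ tsupport (fderiv ℝ f) := fun h => hr x hx' (tsupport_fderiv_subset ℝ h)
      exact image_eq_zero_of_notMem_tsupport this
    simp [h5]
  rw [← integral_add_compl I.measurableSet_coe hG]
  exact add_nonneg hI hIc

lemma integral_nonneg_of_divergence_le {N : ℕ} (hN : 1 ≤ N)
    {X : EuclideanSpace ℝ (Fin N) → EuclideanSpace ℝ (Fin N)}
    (hX : Differentiable ℝ X) (hc : HasCompactSupport X) {G : EuclideanSpace ℝ (Fin N) → ℝ}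
    (hG : Integrable G)
    (hle : ∀ x, ∑ i, ⟪fderiv ℝ X x (EuclideanSpace.basisFun (Fin N) ℝ i),
      EuclideanSpace.basisFun (Fin N) ℝ i⟫ ≤ G x) :
    0 ≤ ∫ x, G x := by
  obtain ⟨n, rfl⟩ : ∃ n, N = n + 1 := ⟨N - 1, by omega⟩
  let e := (EuclideanSpace.equiv (Fin (n + 1)) ℝ)
  have hmp := EuclideanSpace.volume_preserving_symm_measurableEquiv_toLp (Fin (n + 1))
  have hmp' := hmp.symm
  have hint : ∫ x, G (e.symm x) = ∫ x, G x :=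
    hmp'.integral_comp (MeasurableEquiv.measurableEmbedding _) G
  rw [← hint]
  refine integral_nonneg_of_divergence_le_pi (f := fun y => e (X (e.symm y)))
    (e.differentiable.comp (hX.comp e.symm.differentiable)) ?_ ?_ ?_
  · have h1 : HasCompactSupport (X ∘ e.symm) :=
      hc.comp_homeomorph e.symm.toHomeomorph
    exact h1.comp_left (g := e) (map_zero e)
  · exact hmp'.integrable_comp_emb (MeasurableEquiv.measurableEmbedding _) |>.2 hG
  · intro y
    refine le_trans (le_of_eq ?_) (hle (e.symm y))
    refine Finset.sum_congr rfl fun i _ => ?_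
    have h1 : HasFDerivAt (fun y => e (X (e.symm y)))
        ((e : EuclideanSpace ℝ (Fin (n + 1)) →L[ℝ] Fin (n + 1) → ℝ).comp
          ((fderiv ℝ X (e.symm y)).comp
            (e.symm : (Fin (n + 1) → ℝ) →L[ℝ] EuclideanSpace ℝ (Fin (n + 1))))) y :=
      (e.hasFDerivAt).comp y ((hX _).hasFDerivAt.comp y e.symm.hasFDerivAt)
    rw [h1.fderiv]
    have h2 : e.symm (Pi.single i 1) = EuclideanSpace.basisFun (Fin (n + 1)) ℝ i := by
      simp [e]
    simp only [ContinuousLinearMap.comp_apply, ContinuousLinearEquiv.coe_coe, h2]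
    simp [e, EuclideanSpace.inner_single_right]

section Support

variable {E : Type*} [NormedAddCommGroup E] [NormedSpace ℝ E]
  {F : Type*} [NormedAddCommGroup F] [NormedSpace ℝ F]

lemma ContDiffOn.contDiff_of_tsupport_subset {f : E → F} {Ω : Set E} (hΩ : IsOpen Ω)
    (hf : ContDiffOn ℝ 1 f Ω) (hs : tsupport f ⊆ Ω) : ContDiff ℝ 1 f := by
  rw [contDiff_iff_contDiffAt]
  intro x
  by_cases hx : x ∈ tsupport f
  · exact hf.contDiffAt (hΩ.mem_nhds (hs hx))
  · exact contDiffAt_const.congr_of_eventuallyEq (notMem_tsupport_iff_eventuallyEq.1 hx)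

lemma DifferentiableOn.differentiable_of_tsupport_subset {f : E → F} {Ω : Set E} (hΩ : IsOpen Ω)
    (hf : DifferentiableOn ℝ f Ω) (hs : tsupport f ⊆ Ω) : Differentiable ℝ f := by
  intro x
  by_cases hx : x ∈ tsupport f
  · exact hf.differentiableAt (hΩ.mem_nhds (hs hx))
  · exact (differentiableAt_const 0).congr_of_eventuallyEq (notMem_tsupport_iff_eventuallyEq.1 hx)

end Support

section Gradient

variable {E : Type*} [NormedAddCommGroup E] [InnerProductSpace ℝ E] [CompleteSpace E]

lemma norm_gradient_eq_norm_fderiv (u : E → ℝ) (x : E) : ‖gradient u x‖ = ‖fderiv ℝ u x‖ := by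
  simp [gradient]

lemma tsupport_gradient_subset (u : E → ℝ) : tsupport (gradient u) ⊆ tsupport u := by
  refine closure_minimal (fun x hx => ?_) (isClosed_tsupport u)
  by_contra h
  refine hx ?_
  have : fderiv ℝ u x = 0 :=
    image_eq_zero_of_notMem_tsupport fun h' => h (tsupport_fderiv_subset ℝ h')
  simp [gradient, this]

lemma ContDiffOn.continuousOn_gradient {u : E → ℝ} {Ω : Set E} (hΩ : IsOpen Ω)
    (hu : ContDiffOn ℝ 1 u Ω) : ContinuousOn (gradient u) Ω :=
  (InnerProductSpace.toDual ℝ E).symm.continuous.comp_continuousOn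
    (hu.continuousOn_fderiv_of_isOpen hΩ le_rfl)

lemma ContDiff.continuous_gradient {u : E → ℝ} (hu : ContDiff ℝ 1 u) : Continuous (gradient u) :=
  (InnerProductSpace.toDual ℝ E).symm.continuous.comp (hu.continuous_fderiv one_ne_zero)

variable [MeasurableSpace E] [BorelSpace E] [FiniteDimensional ℝ E]

/-- `u` is a weak supersolution of `-Δ_p u ≥ k 1_A` on `Ω`, tested against nonnegative
compactly supported `C¹` functions (for which the flux term is integrable). -/
def IsWeakPSupersolution (p : ℝ) (u : E → ℝ) (k : ℝ) (A Ω : Set E) : Prop :=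
  ∀ φ : E → ℝ, ContDiff ℝ 1 φ → HasCompactSupport φ → tsupport φ ⊆ Ω → (∀ x, 0 ≤ φ x) →
    Integrable (fun x => ⟪‖gradient u x‖ ^ (p - 2) • gradient u x, gradient φ x⟫) ∧
      k * ∫ x in A, φ x ≤ ∫ x, ⟪‖gradient u x‖ ^ (p - 2) • gradient u x, gradient φ x⟫

lemma IsWeakPSupersolution.zero_left {p k : ℝ} {u : E → ℝ} {A Ω : Set E} (hk : 0 ≤ k)
    (h : IsWeakPSupersolution p u k A Ω) : IsWeakPSupersolution p u 0 ∅ Ω := by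
  intro φ h1 h2 h3 h4
  obtain ⟨hi, hle⟩ := h φ h1 h2 h3 h4
  refine ⟨hi, le_trans ?_ hle⟩
  rw [zero_mul]
  exact mul_nonneg hk (integral_nonneg h4)

lemma IsWeakPSupersolution.add_const {p k : ℝ} {u : E → ℝ} {A Ω : Set E}
    (h : IsWeakPSupersolution p u k A Ω) (c : ℝ) :
    IsWeakPSupersolution p (fun x => u x + c) k A Ω := by
  have : gradient (fun x => u x + c) = gradient u := by
    funext x
    simp [gradient]
  intro φ
  rw [this]
  exact h φ

end Gradient

lemma IsPSupersolution.isWeakPSupersolution {N : ℕ} (hN : 1 ≤ N) {p : ℝ}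
    {u g : EuclideanSpace ℝ (Fin N) → ℝ} {Ω A : Set (EuclideanSpace ℝ (Fin N))} (hΩ : IsOpen Ω)
    (hu : IsPSupersolution N p u g Ω) (hA : MeasurableSet A) {k : ℝ}
    (hg : ∀ x ∈ Ω, 0 ≤ g x) (hgA : ∀ x ∈ A ∩ Ω, k ≤ g x) :
    IsWeakPSupersolution p u k A Ω := by
  obtain ⟨-, hF, hdiv⟩ := hu
  intro φ hφ hφc hφs hφ0
  change Integrable (fun x => ⟪pFlux N p u x, gradient φ x⟫) ∧
    _ ≤ ∫ x, ⟪pFlux N p u x, gradient φ x⟫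
  have hcont : Continuous fun x => ⟪pFlux N p u x, gradient φ x⟫ := by
    refine (hF.continuousOn.inner
      hφ.continuous_gradient.continuousOn).continuous_of_tsupport_subset hΩ ?_
    refine (closure_mono ?_).trans ((tsupport_gradient_subset φ).trans hφs)
    intro x hx h0
    exact hx (by simp [h0])
  have hcs : HasCompactSupport fun x => ⟪pFlux N p u x, gradient φ x⟫ := by
    refine HasCompactSupport.mono' hφc fun x hx => tsupport_gradient_subset φ (subset_closure ?_)
    intro h0
    exact hx (by simp [h0])
  have hi1 := hcont.integrable_of_hasCompactSupport (μ := volume) hcs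
  have hi2 : Integrable (A.indicator φ) :=
    (hφ.continuous.integrable_of_hasCompactSupport hφc).indicator hA
  refine ⟨hi1, ?_⟩
  have hts : tsupport (fun x => φ x • pFlux N p u x) ⊆ tsupport φ :=
    tsupport_smul_subset_left φ (pFlux N p u)
  have key := integral_nonneg_of_divergence_le hN (X := fun x => φ x • pFlux N p u x)
    (G := fun x => ⟪pFlux N p u x, gradient φ x⟫ - k * A.indicator φ x)
    (DifferentiableOn.differentiable_of_tsupport_subset hΩ
      ((hφ.differentiable one_ne_zero).differentiableOn.smul hF) (hts.trans hφs))
    hφc.smul_right (hi1.sub (hi2.const_mul k)) ?_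
  · rw [integral_sub hi1 (hi2.const_mul k), integral_const_mul, integral_indicator hA] at key
    linarith
  · intro x
    by_cases hx : x ∈ tsupport φ
    · have hxΩ := hφs hx
      have hd : HasFDerivAt (fun x => φ x • pFlux N p u x) _ x :=
        ((hφ.differentiable one_ne_zero) x).hasFDerivAt.smul
          (hF.differentiableAt (hΩ.mem_nhds hxΩ)).hasFDerivAt
      rw [hd.fderiv]
      have h1 := hdiv x hxΩ
      have h2 : k * A.indicator φ x ≤ φ x * g x := by
        by_cases hxA : x ∈ A
        · rw [Set.indicator_of_mem hxA, mul_comm]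
          exact mul_le_mul_of_nonneg_left (hgA x ⟨hxA, hxΩ⟩) (hφ0 x)
        · rw [Set.indicator_of_notMem hxA, mul_zero]
          exact mul_nonneg (hφ0 x) (hg x hxΩ)
      have h3 : φ x * g x ≤ φ x * (-pLaplacian N p u x) :=
        mul_le_mul_of_nonneg_left h1 (hφ0 x)
      have h4 := OrthonormalBasis.sum_inner_mul_inner (EuclideanSpace.basisFun (Fin N) ℝ)
        (gradient φ x) (pFlux N p u x)
      simp only [inner_gradient_left] at h4
      simp only [_root_.add_apply, _root_.smul_apply,
        ContinuousLinearMap.smulRight_apply, inner_add_left, real_inner_smul_left,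
        Finset.sum_add_distrib, ← Finset.mul_sum]
      rw [← real_inner_comm (pFlux N p u x), inner_gradient_left, ← h4]
      change φ x * pLaplacian N p u x + _ ≤ _
      simp only [real_inner_comm (EuclideanSpace.basisFun (Fin N) ℝ _) (pFlux N p u x)]
      linarith
    · have h1 : fderiv ℝ (fun x => φ x • pFlux N p u x) x = 0 :=
        image_eq_zero_of_notMem_tsupport fun h => hx (hts (tsupport_fderiv_subset ℝ h))
      have h2 : φ x = 0 := image_eq_zero_of_notMem_tsupport hx
      have h3 : gradient φ x = 0 :=
        image_eq_zero_of_notMem_tsupport fun h => hx (tsupport_gradient_subset φ h)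
      by_cases hxA : x ∈ A <;> simp [h1, h2, h3, hxA]

lemma exists_mul_rpow_sub_le {p K : ℝ} (hp : 1 < p) (hK : 0 ≤ K) :
    ∃ C : ℝ, 0 < C ∧ ∀ m X Y : ℝ, 1 ≤ m → 0 ≤ X → 0 ≤ Y → Y ≤ K →
      m * X ^ (p - 1) * Y - (p - 1) * X ^ p ≤ C * m ^ p - (p - 1) / 2 * X := by
  set δ := (p - 1) / 2 with hδ
  have hδ0 : 0 < δ := by rw [hδ]; linarith
  refine ⟨δ + K * (K / δ) ^ (p - 1), by positivity, fun m X Y hm hX hY hYK => ?_⟩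
  have hXp : X ≤ X ^ p + 1 := by
    rcases le_total X 1 with h | h
    · linarith [rpow_nonneg hX p]
    · linarith [self_le_rpow_of_one_le h hp.le]
  have hmp : 1 ≤ m ^ p := one_le_rpow hm (by linarith)
  have hXpow : X ^ (p - 1) * X = X ^ p := by
    conv_lhs => rw [← rpow_one X]
    rw [← rpow_mul hX, one_mul, ← rpow_add_of_nonneg hX (by linarith) zero_le_one]
    ring_nf
  have hX1 : 0 ≤ X ^ (p - 1) := rpow_nonneg hX _
  have hmain : m * X ^ (p - 1) * Y ≤ δ * X ^ p + K * (K / δ) ^ (p - 1) * m ^ p := by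
    rcases le_total (m * Y) (δ * X) with h | h
    · have h1 : m * X ^ (p - 1) * Y ≤ δ * X ^ p := by
        rw [← hXpow]
        nlinarith
      have : 0 ≤ K * (K / δ) ^ (p - 1) * m ^ p := by positivity
      linarith
    · have h1 : X ≤ m * (K / δ) := by
        rw [← mul_div_assoc, le_div_iff₀ hδ0]
        nlinarith
      have h2 : X ^ (p - 1) ≤ m ^ (p - 1) * (K / δ) ^ (p - 1) := by
        rw [← mul_rpow (by linarith) (by positivity)]
        exact rpow_le_rpow hX h1 (by linarith)
      have h3 : m ^ p = m * m ^ (p - 1) := by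
        conv_rhs => rw [← rpow_one m]
        rw [← rpow_mul (by linarith), one_mul, ← rpow_add (by linarith)]
        ring_nf
      calc m * X ^ (p - 1) * Y ≤ m * (m ^ (p - 1) * (K / δ) ^ (p - 1)) * K := by gcongr
        _ = K * (K / δ) ^ (p - 1) * m ^ p := by rw [h3]; ring
        _ ≤ _ := by
          have : 0 ≤ δ * X ^ p := by positivity
          linarith
  have hp2 : (p - 1) * X ^ p = δ * X ^ p + δ * X ^ p := by rw [hδ]; ring
  nlinarith

lemma tsupport_subset_of_eq_zero {X Y Z : Type*} [TopologicalSpace X] [Zero Y] [Zero Z]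
    {f : X → Y} {η : X → Z} (h : ∀ x, η x = 0 → f x = 0) : tsupport f ⊆ tsupport η :=
  closure_mono fun x hx h0 => hx (h x h0)

lemma ContinuousOn.integrable_of_eq_zero {X : Type*} [TopologicalSpace X] [MeasurableSpace X]
    [OpensMeasurableSpace X] {μ : Measure X} [IsFiniteMeasureOnCompacts μ]
    {f η : X → ℝ} {Ω : Set X} (hf : ContinuousOn f Ω) (hΩ : IsOpen Ω) (hη : HasCompactSupport η)
    (hs : tsupport η ⊆ Ω) (h : ∀ x, η x = 0 → f x = 0) : Integrable f μ :=
  (hf.continuous_of_tsupport_subset hΩ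
    ((tsupport_subset_of_eq_zero h).trans hs)).integrable_of_hasCompactSupport
    (hη.mono fun x hx h0 => hx (h x h0))

section Caccioppoli

variable {E : Type*} [NormedAddCommGroup E] [InnerProductSpace ℝ E] [CompleteSpace E]

/-- Pointwise bound for the flux of a supersolution tested against `η ^ (θ + p) u ^ (1 - p) ψ(u)`. -/
lemma inner_flux_gradient_le {p C K : ℝ} (hp : 1 < p)
    (hC : ∀ m X Y : ℝ, 1 ≤ m → 0 ≤ X → 0 ≤ Y → Y ≤ K →
      m * X ^ (p - 1) * Y - (p - 1) * X ^ p ≤ C * m ^ p - (p - 1) / 2 * X)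
    {u η : E → ℝ} {ψ : ℝ → ℝ} {θ : ℝ} {x : E} (hu : DifferentiableAt ℝ u x) (hux : 0 < u x)
    (hη : DifferentiableAt ℝ η x) (hη0 : 0 ≤ η x) (hηK : ‖gradient η x‖ ≤ K)
    (hψ : DifferentiableAt ℝ ψ (u x)) (hψ0 : 0 ≤ ψ (u x)) (hψ' : deriv ψ (u x) ≤ 0)
    (hθ : 1 ≤ θ) :
    ⟪‖gradient u x‖ ^ (p - 2) • gradient u x,
        gradient (fun y => η y ^ (θ + p) * (u y ^ (1 - p) * ψ (u y))) x⟫ ≤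
      C * (θ + p) ^ p * (η x ^ θ * ψ (u x)) -
        (p - 1) / 2 * (η x ^ (θ + 1) * ψ (u x) * (‖gradient u x‖ / u x)) := by
  set m := θ + p with hm
  set t := u x with ht
  set e := η x with he
  set g := ‖gradient u x‖ with hg
  set v := g ^ (p - 2) • gradient u x with hv
  have hg0 : 0 ≤ g := norm_nonneg _
  have hΦ : HasDerivAt (fun s => s ^ (1 - p) * ψ s)
      ((1 - p) * t ^ (1 - p - 1) * ψ t + t ^ (1 - p) * deriv ψ t) t :=
    (hasDerivAt_rpow_const (Or.inl hux.ne')).mul hψ.hasDerivAt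
  have hΦu := hΦ.comp_hasFDerivAt x hu.hasFDerivAt
  have hηm : HasFDerivAt (fun y => η y ^ m) ((m * e ^ (m - 1)) • fderiv ℝ η x) x :=
    (hasDerivAt_rpow_const (Or.inr (by linarith))).comp_hasFDerivAt x hη.hasFDerivAt
  have hprod := (hηm.mul hΦu).fderiv
  simp only [Function.comp_def] at hprod
  rw [inner_gradient_right]
  simp only [conj_trivial]
  have hprod' : fderiv ℝ (fun y => η y ^ m * (u y ^ (1 - p) * ψ (u y))) x v =
      e ^ m * (((1 - p) * t ^ (1 - p - 1) * ψ t + t ^ (1 - p) * deriv ψ t) * fderiv ℝ u x v) +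
        t ^ (1 - p) * ψ t * (m * e ^ (m - 1) * fderiv ℝ η x v) := by
    refine (congrArg (fun L : E →L[ℝ] ℝ => L v) hprod).trans ?_
    simp [he, ht]
  rw [hprod']
  have huv : fderiv ℝ u x v = g ^ p := by
    rw [← inner_gradient_left, hv, inner_smul_right, real_inner_self_eq_norm_sq, ← hg]
    rcases hg0.eq_or_lt with h | h
    · rw [← h, zero_rpow (by linarith : p ≠ 0)]
      simp
    · rw [← rpow_natCast, ← rpow_add h]
      norm_num
  have hηv : fderiv ℝ η x v ≤ g ^ (p - 1) * ‖gradient η x‖ := by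
    rw [← inner_gradient_left]
    refine (real_inner_le_norm _ _).trans (le_of_eq ?_)
    rw [hv, norm_smul, norm_of_nonneg (rpow_nonneg hg0 _), ← hg, mul_comm]
    congr 1
    rcases hg0.eq_or_lt with h | h
    · rw [← h, zero_rpow (by linarith : p - 1 ≠ 0)]
      simp
    · nth_rw 2 [← rpow_one g]
      rw [← rpow_add h]
      ring_nf
  have hX0 : 0 ≤ e * (g / t) := by positivity
  have hXp : e ^ m * (t ^ (1 - p - 1) * g ^ p) = e ^ θ * (e * (g / t)) ^ p := by
    rw [mul_rpow hη0 (by positivity), div_rpow hg0 hux.le,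
      show m = θ + p from rfl, rpow_add_of_nonneg hη0 (by linarith) (by linarith),
      show 1 - p - 1 = -p by ring, rpow_neg hux.le]
    ring
  have hXp1 : e ^ (m - 1) * (t ^ (1 - p) * g ^ (p - 1)) = e ^ θ * (e * (g / t)) ^ (p - 1) := by
    rw [mul_rpow hη0 (by positivity), div_rpow hg0 hux.le,
      show m - 1 = θ + (p - 1) by rw [hm]; ring,
      rpow_add_of_nonneg hη0 (by linarith) (by linarith),
      show 1 - p = -(p - 1) by ring, rpow_neg hux.le]
    ring
  have he1 : e ^ (θ + 1) = e ^ θ * e := by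
    rw [rpow_add_of_nonneg hη0 (by linarith) zero_le_one, rpow_one]
  have key := mul_le_mul_of_nonneg_left
    (hC m (e * (g / t)) ‖gradient η x‖ (by linarith) hX0 (norm_nonneg _) hηK)
    (mul_nonneg (rpow_nonneg hη0 θ) hψ0)
  have h1 : 0 ≤ e ^ m * (t ^ (1 - p) * g ^ p) := by positivity
  have h2 : 0 ≤ t ^ (1 - p) * ψ t * (m * e ^ (m - 1)) := by
    have : 0 ≤ m := by linarith
    positivity
  calc _ = (1 - p) * ψ t * (e ^ m * (t ^ (1 - p - 1) * g ^ p))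
        + deriv ψ t * (e ^ m * (t ^ (1 - p) * g ^ p))
        + t ^ (1 - p) * ψ t * (m * e ^ (m - 1)) * fderiv ℝ η x v := by rw [huv]; ring
    _ ≤ (1 - p) * ψ t * (e ^ m * (t ^ (1 - p - 1) * g ^ p)) + 0
        + t ^ (1 - p) * ψ t * (m * e ^ (m - 1)) * (g ^ (p - 1) * ‖gradient η x‖) := by
      gcongr
      exact mul_nonpos_of_nonpos_of_nonneg hψ' h1
    _ = e ^ θ * ψ t * (m * (e * (g / t)) ^ (p - 1) * ‖gradient η x‖ -
          (p - 1) * (e * (g / t)) ^ p) := by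
      rw [hXp]
      linear_combination m * ψ t * ‖gradient η x‖ * hXp1
    _ ≤ _ := key
    _ = _ := by rw [he1]; ring

variable [MeasurableSpace E] [BorelSpace E] [FiniteDimensional ℝ E]

/-- Logarithmic Caccioppoli inequality for positive weak supersolutions. -/
lemma exists_caccioppoli {p K : ℝ} (hp : 1 < p) (hK : 0 ≤ K) :
    ∃ C : ℝ, 0 < C ∧ ∀ (Ω A : Set E) (k : ℝ) (u η : E → ℝ) (ψ : ℝ → ℝ) (θ : ℝ), IsOpen Ω →
      ContDiffOn ℝ 1 u Ω → (∀ x ∈ Ω, 0 < u x) → IsWeakPSupersolution p u k A Ω →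
      ContDiff ℝ 1 η → HasCompactSupport η → tsupport η ⊆ Ω → (∀ x, 0 ≤ η x) →
      (∀ x, ‖gradient η x‖ ≤ K) →
      ContDiffOn ℝ 1 ψ (Set.Ioi 0) → (∀ t > 0, 0 ≤ ψ t) → (∀ t > 0, deriv ψ t ≤ 0) → 1 ≤ θ →
      k * (∫ x in A, η x ^ (θ + p) * (u x ^ (1 - p) * ψ (u x))) +
        (p - 1) / 2 * (∫ x, η x ^ (θ + 1) * ψ (u x) * (‖gradient u x‖ / u x)) ≤
        C * (θ + p) ^ p * ∫ x, η x ^ θ * ψ (u x) := by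
  obtain ⟨C, hC0, hC⟩ := exists_mul_rpow_sub_le (K := K) hp hK
  refine ⟨C, hC0, fun Ω A k u η ψ θ hΩ hu hu0 hw hη hηc hηs hη0 hηK hψ hψ0 hψ' hθ => ?_⟩
  have hηz : ∀ x, x ∉ Ω → η x = 0 := fun x hx =>
    image_eq_zero_of_notMem_tsupport fun h => hx (hηs h)
  have hψu : ContDiffOn ℝ 1 (fun x => ψ (u x)) Ω := hψ.comp hu hu0
  set φ : E → ℝ := fun x => η x ^ (θ + p) * (u x ^ (1 - p) * ψ (u x)) with hφ
  have hφz : ∀ x, η x = 0 → φ x = 0 := fun x hx => by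
    simp [hφ, hx, zero_rpow (by linarith : θ + p ≠ 0)]
  have hφts : tsupport φ ⊆ tsupport η := tsupport_subset_of_eq_zero hφz
  have hφ1 : ContDiff ℝ 1 φ := by
    refine ContDiffOn.contDiff_of_tsupport_subset hΩ ?_ (hφts.trans hηs)
    refine ContDiffOn.mul ?_ ((hu.rpow_const_of_ne fun x hx => (hu0 x hx).ne').mul hψu)
    exact (hη.rpow_const_of_le (by simp; linarith)).contDiffOn
  have hφ0 : ∀ x, 0 ≤ φ x := fun x => by
    by_cases hx : x ∈ Ω
    · exact mul_nonneg (rpow_nonneg (hη0 x) _)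
        (mul_nonneg (rpow_nonneg (hu0 x hx).le _) (hψ0 _ (hu0 x hx)))
    · rw [hφz x (hηz x hx)]
  obtain ⟨hint0, hweak⟩ := hw φ hφ1 (hηc.mono fun x hx h0 => hx (hφz x h0)) (hφts.trans hηs) hφ0
  have hi1 : Integrable fun x => η x ^ θ * ψ (u x) := by
    refine ContinuousOn.integrable_of_eq_zero (Ω := Ω) ?_ hΩ hηc hηs fun x hx => ?_
    · exact (hη.continuous.continuousOn.rpow_const fun x _ => Or.inr (by linarith)).mul
        hψu.continuousOn
    · simp [hx, zero_rpow (by linarith : θ ≠ 0)]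
  have hi2 : Integrable fun x => η x ^ (θ + 1) * ψ (u x) * (‖gradient u x‖ / u x) := by
    refine ContinuousOn.integrable_of_eq_zero (Ω := Ω) ?_ hΩ hηc hηs fun x hx => ?_
    · exact ((hη.continuous.continuousOn.rpow_const fun x _ => Or.inr (by linarith)).mul
        hψu.continuousOn).mul ((hu.continuousOn_gradient hΩ).norm.div hu.continuousOn
        fun x hx => (hu0 x hx).ne')
    · simp [hx, zero_rpow (by linarith : θ + 1 ≠ 0)]
  have hpt : ∀ x, ⟪‖gradient u x‖ ^ (p - 2) • gradient u x, gradient φ x⟫ ≤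
      C * (θ + p) ^ p * (η x ^ θ * ψ (u x)) -
        (p - 1) / 2 * (η x ^ (θ + 1) * ψ (u x) * (‖gradient u x‖ / u x)) := by
    intro x
    by_cases hx : x ∈ Ω
    · have hux := hu0 x hx
      exact inner_flux_gradient_le hp hC
        ((hu.differentiableOn one_ne_zero).differentiableAt (hΩ.mem_nhds hx)) hux
        (hη.differentiable one_ne_zero x) (hη0 x) (hηK x)
        ((hψ.differentiableOn one_ne_zero).differentiableAt (Ioi_mem_nhds hux)) (hψ0 _ hux)
        (hψ' _ hux) hθ
    · have hg : gradient φ x = 0 := image_eq_zero_of_notMem_tsupport fun h =>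
        hx (hηs (hφts (tsupport_gradient_subset φ h)))
      simp [hg, hηz x hx, zero_rpow (by linarith : θ ≠ 0), zero_rpow (by linarith : θ + 1 ≠ 0)]
  have hint : ∫ x, ⟪‖gradient u x‖ ^ (p - 2) • gradient u x, gradient φ x⟫ ≤
      C * (θ + p) ^ p * (∫ x, η x ^ θ * ψ (u x)) -
        (p - 1) / 2 * (∫ x, η x ^ (θ + 1) * ψ (u x) * (‖gradient u x‖ / u x)) := by
    rw [← integral_const_mul, ← integral_const_mul,
      ← integral_sub (hi1.const_mul _) (hi2.const_mul _)]
    exact integral_mono hint0 ((hi1.const_mul _).sub (hi2.const_mul _)) hpt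
  linarith

end Caccioppoli

/-- A superlinear recursive inequality with geometric constants forces at most
`(T J₀) ^ (κ ^ n)` growth. -/
lemma exists_le_rpow_of_le_rpow {κ b C : ℝ} (hκ : 1 < κ) (hb : 1 ≤ b) (hC : 0 < C) :
    ∃ T : ℝ, 0 < T ∧ ∀ J : ℕ → ℝ, (∀ n, 0 ≤ J n) → (∀ n, J (n + 1) ≤ (C * b ^ n * J n) ^ κ) →
      ∀ n, J n ≤ (T * J 0) ^ (κ ^ n) := by
  have hκ1 : 0 < κ - 1 := by linarith
  set D := b ^ (κ / (κ - 1)) with hD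
  have hD1 : 1 ≤ D := one_le_rpow hb (by positivity)
  have hDκ : D ^ κ = D * b ^ κ := by
    rw [hD, ← rpow_mul (by linarith), ← rpow_add (by linarith)]
    congr 1
    field_simp
    ring
  set T := max 1 ((C ^ κ * D) ^ (1 / (κ - 1))) with hT
  have hT1 : 1 ≤ T := le_max_left _ _
  have hTκ : T * D * C ^ κ ≤ T ^ κ := by
    have h1 : C ^ κ * D ≤ T ^ (κ - 1) := by
      calc C ^ κ * D = ((C ^ κ * D) ^ (1 / (κ - 1))) ^ (κ - 1) := by
            rw [← rpow_mul (by positivity), one_div_mul_cancel hκ1.ne', rpow_one]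
        _ ≤ T ^ (κ - 1) := rpow_le_rpow (by positivity) (le_max_right _ _) hκ1.le
    have h2 : T ^ κ = T * T ^ (κ - 1) := by
      conv_rhs => rw [← rpow_one T]
      rw [← rpow_mul (by linarith), one_mul, ← rpow_add (by linarith)]
      ring_nf
    rw [h2]
    nlinarith
  refine ⟨T, by linarith, fun J hJ hrec n => ?_⟩
  have key : ∀ n, T * D ^ n * J n ≤ (T * J 0) ^ (κ ^ n) := by
    intro n
    induction n with
    | zero => simp
    | succ n ih =>
      have hDn : (D ^ n) ^ κ = D ^ n * (b ^ n) ^ κ := by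
        rw [← rpow_natCast_mul (by linarith), mul_comm, rpow_mul_natCast (by linarith), hDκ,
          mul_pow, ← rpow_natCast_mul (by linarith), mul_comm (n : ℝ), rpow_mul_natCast (by linarith)]
      have hJn := hJ n
      calc T * D ^ (n + 1) * J (n + 1)
          ≤ T * D ^ (n + 1) * (C * b ^ n * J n) ^ κ := by gcongr; exact hrec n
        _ = T * D * C ^ κ * (D ^ n * (b ^ n) ^ κ * J n ^ κ) := by
          rw [mul_rpow (by positivity) hJn, mul_rpow hC.le (by positivity)]
          ring
        _ ≤ T ^ κ * (D ^ n * (b ^ n) ^ κ * J n ^ κ) := by gcongr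
        _ = (T * D ^ n * J n) ^ κ := by
          rw [mul_rpow (by positivity) hJn, mul_rpow (by positivity) (by positivity), hDn]
          ring
        _ ≤ ((T * J 0) ^ (κ ^ n)) ^ κ := by gcongr
        _ = (T * J 0) ^ (κ ^ (n + 1)) := by
          rw [← rpow_mul (mul_nonneg (by linarith) (hJ 0)), pow_succ]
  refine le_trans ?_ (key n)
  have h1 : 1 ≤ T * D ^ n := one_le_mul_of_one_le_of_one_le hT1 (one_le_pow₀ hD1)
  nlinarith [hJ n]

/-- The profile `t ↦ 1 + log (1 + a / t)`. -/
noncomputable def logProfile (a t : ℝ) : ℝ := 1 + log (1 + a / t)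

section logProfile

variable {a t : ℝ}

lemma one_le_logProfile (ha : 0 < a) (ht : 0 < t) : 1 ≤ logProfile a t := by
  have : 0 ≤ log (1 + a / t) := log_nonneg (by linarith [div_pos ha ht])
  unfold logProfile
  linarith

lemma hasDerivAt_logProfile (ha : 0 < a) (ht : 0 < t) :
    HasDerivAt (logProfile a) (-(a / (t * (t + a)))) t := by
  have h1 : HasDerivAt (fun s => 1 + a / s) (-(a / t ^ 2)) t := by
    have := ((hasDerivAt_inv ht.ne').const_mul a).const_add 1
    refine this.congr_deriv ?_
    field_simp
  have h2 : 0 < 1 + a / t := by positivity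
  refine ((h1.log h2.ne').const_add 1).congr_deriv ?_
  field_simp

lemma contDiffOn_logProfile (ha : 0 < a) : ContDiffOn ℝ 1 (logProfile a) (Set.Ioi 0) := by
  intro t (ht : 0 < t)
  have h2 : 1 + a / t ≠ 0 := by positivity
  refine ContDiffAt.contDiffWithinAt ?_
  exact contDiffAt_const.add ((contDiffAt_const.add
    (contDiffAt_const.div contDiffAt_id ht.ne')).log h2)

end logProfile

section LogProfileGradient

variable {E : Type*} [NormedAddCommGroup E] [InnerProductSpace ℝ E] [CompleteSpace E]

lemma norm_fderiv_cutoff_mul_logProfile_le {u η : E → ℝ} {a K θ s : ℝ} {x : E} (ha : 0 < a)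
    (hu : DifferentiableAt ℝ u x) (hux : 0 < u x) (hη : DifferentiableAt ℝ η x)
    (hη0 : 0 ≤ η x) (hηK : ‖gradient η x‖ ≤ K) (hθ : 1 ≤ θ) (hs : 1 ≤ s) :
    ‖fderiv ℝ (fun y => η y ^ (θ + 1) * logProfile a (u y) ^ s) x‖ ≤
      (θ + 1) * K * (η x ^ θ * logProfile a (u x) ^ s) +
        s * (η x ^ (θ + 1) * logProfile a (u x) ^ (s - 1) * (‖gradient u x‖ / u x)) := by
  have hL := one_le_logProfile ha hux
  have hL0 : 0 < logProfile a (u x) := by linarith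
  have h1 : HasFDerivAt (fun y => η y ^ (θ + 1)) (((θ + 1) * η x ^ (θ + 1 - 1)) • fderiv ℝ η x) x :=
    (hasDerivAt_rpow_const (Or.inr (by linarith))).comp_hasFDerivAt x hη.hasFDerivAt
  have h2 : HasDerivAt (fun r => logProfile a r ^ s)
      (-(a / (u x * (u x + a))) * s * logProfile a (u x) ^ (s - 1)) (u x) :=
    (hasDerivAt_logProfile ha hux).rpow_const (Or.inl hL0.ne')
  have h3 := (h1.mul (h2.comp_hasFDerivAt x hu.hasFDerivAt)).fderiv
  simp only [Function.comp_def] at h3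
  refine (congrArg norm h3).trans_le ?_
  have hfrac : a / (u x * (u x + a)) ≤ 1 / u x := by
    rw [div_le_div_iff₀ (by positivity) hux]
    nlinarith
  refine (norm_add_le _ _).trans ?_
  rw [norm_smul, norm_smul, norm_smul, norm_smul, ← norm_gradient_eq_norm_fderiv,
    ← norm_gradient_eq_norm_fderiv, add_comm, add_sub_cancel_right]
  have e1 : ‖logProfile a (u x) ^ s‖ = logProfile a (u x) ^ s := norm_of_nonneg (by positivity)
  have e2 : ‖η x ^ (θ + 1)‖ = η x ^ (θ + 1) := norm_of_nonneg (by positivity)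
  have e3 : ‖(θ + 1) * η x ^ θ‖ = (θ + 1) * η x ^ θ :=
    norm_of_nonneg (mul_nonneg (by linarith) (by positivity))
  have e4 : ‖-(a / (u x * (u x + a))) * s * logProfile a (u x) ^ (s - 1)‖ =
      a / (u x * (u x + a)) * s * logProfile a (u x) ^ (s - 1) := by
    rw [neg_mul, neg_mul, norm_neg]
    exact norm_of_nonneg (by positivity)
  rw [e1, e2, e3, e4]
  refine add_le_add ?_ ?_
  · calc logProfile a (u x) ^ s * ((θ + 1) * η x ^ θ * ‖gradient η x‖)
        ≤ logProfile a (u x) ^ s * ((θ + 1) * η x ^ θ * K) := by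
          have : 0 ≤ (θ + 1) * η x ^ θ := mul_nonneg (by linarith) (by positivity)
          gcongr
      _ = _ := by ring
  · calc η x ^ (θ + 1) * (a / (u x * (u x + a)) * s * logProfile a (u x) ^ (s - 1) *
          ‖gradient u x‖)
        ≤ η x ^ (θ + 1) * (1 / u x * s * logProfile a (u x) ^ (s - 1) * ‖gradient u x‖) := by
          gcongr
      _ = _ := by ring

end LogProfileGradient

section Sobolev

variable {E : Type*} [NormedAddCommGroup E] [InnerProductSpace ℝ E]
  [MeasurableSpace E] [BorelSpace E] [FiniteDimensional ℝ E]

/-- The `L¹` Gagliardo-Nirenberg-Sobolev inequality in terms of Bochner integrals. -/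
lemma exists_integral_rpow_le_integral_norm_fderiv {κ : ℝ}
    (hκ : Real.HolderConjugate (Module.finrank ℝ E) κ) :
    ∃ C : ℝ, 0 < C ∧ ∀ v : E → ℝ, ContDiff ℝ 1 v → HasCompactSupport v → (∀ x, 0 ≤ v x) →
      ∫ x, v x ^ κ ≤ (C * ∫ x, ‖fderiv ℝ v x‖) ^ κ := by
  set c : ℝ := (lintegralPowLePowLIntegralFDerivConst (volume : Measure E) κ : ℝ) + 1
  have hc : 0 < c := by positivity
  have hκ0 : 0 < κ := hκ.symm.pos
  refine ⟨c ^ (1 / κ), by positivity, fun v hv hvc hv0 => ?_⟩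
  have h := lintegral_pow_le_pow_lintegral_fderiv (volume : Measure E) hv hvc hκ
  have hi1 : Integrable fun x => ‖fderiv ℝ v x‖ :=
    ((hv.continuous_fderiv one_ne_zero).integrable_of_hasCompactSupport (hvc.fderiv ℝ)).norm
  have hi2 : Integrable fun x => v x ^ κ := by
    refine (hv.continuous.rpow_const fun x => Or.inr hκ0.le).integrable_of_hasCompactSupport
      (hvc.mono fun x hx h0 => hx ?_)
    simp [h0, zero_rpow hκ0.ne']
  have e1 : ∫⁻ x, ‖v x‖ₑ ^ κ = ENNReal.ofReal (∫ x, v x ^ κ) := by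
    rw [ofReal_integral_eq_lintegral_ofReal hi2 (ae_of_all _ fun x => rpow_nonneg (hv0 x) _)]
    refine lintegral_congr fun x => ?_
    rw [Real.enorm_eq_ofReal (hv0 x), ENNReal.ofReal_rpow_of_nonneg (hv0 x) hκ0.le]
  have e2 : ∫⁻ x, ‖fderiv ℝ v x‖ₑ = ENNReal.ofReal (∫ x, ‖fderiv ℝ v x‖) := by
    rw [ofReal_integral_eq_lintegral_ofReal hi1 (ae_of_all _ fun x => norm_nonneg _)]
    exact lintegral_congr fun x => (ofReal_norm _).symm
  have hnn : 0 ≤ ∫ x, ‖fderiv ℝ v x‖ := integral_nonneg fun x => norm_nonneg _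
  rw [e1, e2, ENNReal.ofReal_rpow_of_nonneg hnn hκ0.le, ← ENNReal.ofReal_coe_nnreal,
    ← ENNReal.ofReal_mul (by positivity), ENNReal.ofReal_le_ofReal_iff (by positivity)] at h
  rw [mul_rpow (by positivity) hnn, ← rpow_mul hc.le, one_div_mul_cancel hκ0.ne', rpow_one]
  refine h.trans (mul_le_mul_of_nonneg_right ?_ (by positivity))
  simp [c]

end Sobolev

section Moser

variable {E : Type*} [NormedAddCommGroup E] [InnerProductSpace ℝ E] [CompleteSpace E]
  [MeasurableSpace E] [BorelSpace E] [FiniteDimensional ℝ E]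

/-- One step of the Moser iteration for `1 + log (1 + a / u)`. -/
lemma exists_moser_step {p K κ : ℝ} (hp : 1 < p) (hK : 0 ≤ K)
    (hκ : Real.HolderConjugate (Module.finrank ℝ E) κ) :
    ∃ C : ℝ, 0 < C ∧ ∀ (Ω : Set E) (u η : E → ℝ) (a θ s : ℝ), IsOpen Ω →
      ContDiffOn ℝ 1 u Ω → (∀ x ∈ Ω, 0 < u x) → IsWeakPSupersolution p u 0 ∅ Ω →
      ContDiff ℝ 1 η → HasCompactSupport η → tsupport η ⊆ Ω → (∀ x, 0 ≤ η x) →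
      (∀ x, ‖gradient η x‖ ≤ K) → 0 < a → 1 ≤ θ → 1 ≤ s →
      ∫ x, η x ^ (κ * (θ + 1)) * logProfile a (u x) ^ (κ * s) ≤
        (C * (s * (θ + p) ^ p) * ∫ x, η x ^ θ * logProfile a (u x) ^ s) ^ κ := by
  obtain ⟨C₁, hC₁, hcac⟩ := exists_caccioppoli (E := E) hp hK
  obtain ⟨C₂, hC₂, hsob⟩ := exists_integral_rpow_le_integral_norm_fderiv (E := E) hκ
  have hκ0 : 0 < κ := hκ.symm.pos
  refine ⟨C₂ * (K + 2 / (p - 1) * C₁), mul_pos hC₂ ?_, fun Ω u η a θ s hΩ hu hu0 hw hη hηc hηs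
    hη0 hηK ha hθ hs => ?_⟩
  · have : 0 < p - 1 := by linarith
    positivity
  have hp1 : 0 < p - 1 := by linarith
  have hηz : ∀ x, x ∉ Ω → η x = 0 := fun x hx =>
    image_eq_zero_of_notMem_tsupport fun h => hx (hηs h)
  have hL : ∀ x ∈ Ω, 1 ≤ logProfile a (u x) := fun x hx => one_le_logProfile ha (hu0 x hx)
  have hLu : ContDiffOn ℝ 1 (fun x => logProfile a (u x)) Ω :=
    (contDiffOn_logProfile ha).comp hu hu0
  have hLpow : ∀ r : ℝ, ContDiffOn ℝ 1 (fun x => logProfile a (u x) ^ r) Ω := fun r =>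
    hLu.rpow_const_of_ne fun x hx => by linarith [hL x hx]
  have hηpow : ∀ r : ℝ, 0 ≤ r → ContinuousOn (fun x => η x ^ r) Ω := fun r hr =>
    hη.continuous.continuousOn.rpow_const fun x _ => Or.inr hr
  set v : E → ℝ := fun x => η x ^ (θ + 1) * logProfile a (u x) ^ s with hv
  have hvz : ∀ x, η x = 0 → v x = 0 := fun x hx => by
    simp [hv, hx, zero_rpow (by linarith : θ + 1 ≠ 0)]
  have hvts : tsupport v ⊆ tsupport η := tsupport_subset_of_eq_zero hvz
  have hv1 : ContDiff ℝ 1 v := by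
    refine ContDiffOn.contDiff_of_tsupport_subset hΩ ?_ (hvts.trans hηs)
    exact (hη.rpow_const_of_le (by simp; linarith)).contDiffOn.mul (hLpow s)
  have hvc : HasCompactSupport v := hηc.mono fun x hx h0 => hx (hvz x h0)
  have hv0 : ∀ x, 0 ≤ v x := fun x => by
    by_cases hx : x ∈ Ω
    · exact mul_nonneg (rpow_nonneg (hη0 x) _) (rpow_nonneg (by linarith [hL x hx]) _)
    · rw [hvz x (hηz x hx)]
  have hi1 : Integrable fun x => η x ^ θ * logProfile a (u x) ^ s := by
    refine ContinuousOn.integrable_of_eq_zero (Ω := Ω) ?_ hΩ hηc hηs fun x hx => ?_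
    · exact (hηpow θ (by linarith)).mul (hLpow s).continuousOn
    · simp [hx, zero_rpow (by linarith : θ ≠ 0)]
  have hi1' : Integrable fun x => η x ^ θ * logProfile a (u x) ^ (s - 1) := by
    refine ContinuousOn.integrable_of_eq_zero (Ω := Ω) ?_ hΩ hηc hηs fun x hx => ?_
    · exact (hηpow θ (by linarith)).mul (hLpow _).continuousOn
    · simp [hx, zero_rpow (by linarith : θ ≠ 0)]
  have hi2 : Integrable fun x =>
      η x ^ (θ + 1) * logProfile a (u x) ^ (s - 1) * (‖gradient u x‖ / u x) := by
    refine ContinuousOn.integrable_of_eq_zero (Ω := Ω) ?_ hΩ hηc hηs fun x hx => ?_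
    · exact ((hηpow (θ + 1) (by linarith)).mul (hLpow _).continuousOn).mul
        ((hu.continuousOn_gradient hΩ).norm.div hu.continuousOn fun x hx => (hu0 x hx).ne')
    · simp [hx, zero_rpow (by linarith : θ + 1 ≠ 0)]
  have hC := hcac Ω ∅ 0 u η (fun t => logProfile a t ^ (s - 1)) θ hΩ hu hu0 hw hη hηc hηs hη0 hηK
    ((contDiffOn_logProfile ha).rpow_const_of_ne fun t ht => by
      linarith [one_le_logProfile ha ht])
    (fun t ht => rpow_nonneg (by linarith [one_le_logProfile ha ht]) _)
    (fun t ht => by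
      have h1 := one_le_logProfile ha ht
      rw [((hasDerivAt_logProfile ha ht).rpow_const (p := s - 1) (Or.inl (by linarith))).deriv,
        neg_mul, neg_mul]
      have : 0 ≤ s - 1 := by linarith
      have : 0 ≤ logProfile a t ^ (s - 1 - 1) := rpow_nonneg (by linarith) _
      have : 0 ≤ a / (t * (t + a)) := by positivity
      exact neg_nonpos.2 (by positivity)) hθ
  rw [zero_mul, zero_add] at hC
  set J := ∫ x, η x ^ θ * logProfile a (u x) ^ s with hJ
  have hJ0 : 0 ≤ J := integral_nonneg fun x => by
    by_cases hx : x ∈ Ω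
    · exact mul_nonneg (rpow_nonneg (hη0 x) _) (rpow_nonneg (by linarith [hL x hx]) _)
    · simp [hηz x hx, zero_rpow (by linarith : θ ≠ 0)]
  have hJ' : ∫ x, η x ^ θ * logProfile a (u x) ^ (s - 1) ≤ J := by
    refine integral_mono hi1' hi1 fun x => ?_
    by_cases hx : x ∈ Ω
    · exact mul_le_mul_of_nonneg_left (rpow_le_rpow_of_exponent_le (hL x hx) (by linarith))
        (rpow_nonneg (hη0 x) _)
    · simp [hηz x hx, zero_rpow (by linarith : θ ≠ 0)]
  have hmp : θ + 1 ≤ (θ + p) ^ p := by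
    have := self_le_rpow_of_one_le (by linarith : 1 ≤ θ + p) hp.le
    linarith
  have hgrad : ∫ x, ‖fderiv ℝ v x‖ ≤ (K + 2 / (p - 1) * C₁) * (s * (θ + p) ^ p) * J := by
    have hpt : ∀ x, ‖fderiv ℝ v x‖ ≤ (θ + 1) * K * (η x ^ θ * logProfile a (u x) ^ s) +
        s * (η x ^ (θ + 1) * logProfile a (u x) ^ (s - 1) * (‖gradient u x‖ / u x)) := by
      intro x
      by_cases hx : x ∈ Ω
      · exact norm_fderiv_cutoff_mul_logProfile_le ha
          ((hu.differentiableOn one_ne_zero).differentiableAt (hΩ.mem_nhds hx)) (hu0 x hx)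
          (hη.differentiable one_ne_zero x) (hη0 x) (hηK x) hθ hs
      · have h1 : fderiv ℝ v x = 0 := image_eq_zero_of_notMem_tsupport fun h =>
          hx (hηs (hvts (tsupport_fderiv_subset ℝ h)))
        simp [h1, hηz x hx, zero_rpow (by linarith : θ ≠ 0), zero_rpow (by linarith : θ + 1 ≠ 0)]
    have h1 := integral_mono
      ((hv1.continuous_fderiv one_ne_zero).integrable_of_hasCompactSupport (hvc.fderiv ℝ)).norm
      ((hi1.const_mul _).add (hi2.const_mul _)) hpt
    simp only [Pi.add_apply] at h1
    rw [integral_add (hi1.const_mul _) (hi2.const_mul _), integral_const_mul,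
      integral_const_mul] at h1
    have h2 : ∫ x, η x ^ (θ + 1) * logProfile a (u x) ^ (s - 1) * (‖gradient u x‖ / u x) ≤
        2 / (p - 1) * (C₁ * (θ + p) ^ p * J) := by
      rw [div_mul_eq_mul_div, le_div_iff₀ hp1]
      have : C₁ * (θ + p) ^ p * ∫ x, η x ^ θ * logProfile a (u x) ^ (s - 1) ≤
          C₁ * (θ + p) ^ p * J := by gcongr
      linarith
    have h3 : (θ + 1) * K * J ≤ s * (θ + p) ^ p * K * J := by
      have : θ + 1 ≤ s * (θ + p) ^ p := by nlinarith
      gcongr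
    calc _ ≤ _ := h1
      _ ≤ s * (θ + p) ^ p * K * J + s * (2 / (p - 1) * (C₁ * (θ + p) ^ p * J)) := by gcongr
      _ = _ := by ring
  have hvκ : ∫ x, v x ^ κ = ∫ x, η x ^ (κ * (θ + 1)) * logProfile a (u x) ^ (κ * s) := by
    refine integral_congr_ae (ae_of_all _ fun x => ?_)
    by_cases hx : x ∈ Ω
    · simp only [hv]
      rw [mul_rpow (rpow_nonneg (hη0 x) _) (rpow_nonneg (by linarith [hL x hx]) _),
        ← rpow_mul (hη0 x), ← rpow_mul (by linarith [hL x hx]), mul_comm κ, mul_comm κ]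
    · have h1 := hηz x hx
      have h2 : κ * (θ + 1) ≠ 0 := by positivity
      simp [hvz x h1, h1, zero_rpow hκ0.ne', zero_rpow h2]
  rw [← hvκ]
  refine (hsob v hv1 hvc hv0).trans (rpow_le_rpow ?_ ?_ hκ0.le)
  · exact mul_nonneg hC₂.le (integral_nonneg fun x => norm_nonneg _)
  · calc C₂ * ∫ x, ‖fderiv ℝ v x‖ ≤ C₂ * ((K + 2 / (p - 1) * C₁) * (s * (θ + p) ^ p) * J) := by
          gcongr
      _ = _ := by ring

/-- Moser's local boundedness of `1 + log (1 + a / u)` for positive supersolutions `u`. -/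
lemma exists_logProfile_le {p K : ℝ} (hp : 1 < p) (hK : 0 ≤ K) (hN : 2 ≤ Module.finrank ℝ E) :
    ∃ T : ℝ, 0 < T ∧ ∀ (Ω : Set E) (u η : E → ℝ) (a : ℝ), IsOpen Ω →
      ContDiffOn ℝ 1 u Ω → (∀ x ∈ Ω, 0 < u x) → IsWeakPSupersolution p u 0 ∅ Ω →
      ContDiff ℝ 1 η → HasCompactSupport η → tsupport η ⊆ Ω → (∀ x, 0 ≤ η x) →
      (∀ x, ‖gradient η x‖ ≤ K) → 0 < a → ∀ x, (∀ᶠ y in 𝓝 x, η y = 1) →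
      logProfile a (u x) ≤ T * ∫ y, η y * logProfile a (u y) := by
  set N : ℝ := ((Module.finrank ℝ E : ℕ) : ℝ) with hNdef
  have hN2 : (2 : ℝ) ≤ N := by rw [hNdef]; exact_mod_cast hN
  set κ := Real.conjExponent N
  have hconj : Real.HolderConjugate N κ := .conjExponent (by linarith)
  have hκ1 : 1 < κ := hconj.symm.lt
  have hκN : κ * (N - 1) = N := by
    simp only [κ, Real.conjExponent]
    exact div_mul_cancel₀ _ (by linarith)
  obtain ⟨C, hC, hstep⟩ := exists_moser_step (E := E) hp hK hconj
  have hbκ : 1 ≤ κ ^ p := one_le_rpow hκ1.le (by linarith)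
  obtain ⟨T, hT, hiter⟩ := exists_le_rpow_of_le_rpow (κ := κ) (b := κ * κ ^ p)
    (C := C * (N + 1 + p) ^ p) hκ1 (by nlinarith) (by positivity)
  refine ⟨T, hT, fun Ω u η a hΩ hu hu0 hw hη hηc hηs hη0 hηK ha x hx => ?_⟩
  have hηz : ∀ x, x ∉ Ω → η x = 0 := fun x hx =>
    image_eq_zero_of_notMem_tsupport fun h => hx (hηs h)
  have hL : ∀ x ∈ Ω, 1 ≤ logProfile a (u x) := fun x hx => one_le_logProfile ha (hu0 x hx)
  set θ : ℕ → ℝ := fun n => κ ^ n * (N + 1) - N with hθ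
  have hκn : ∀ n : ℕ, 1 ≤ κ ^ n := fun n => one_le_pow₀ hκ1.le
  have hθ1 : ∀ n, 1 ≤ θ n := fun n => by
    have := hκn n
    simp only [hθ]
    nlinarith
  have hθs : ∀ n, κ * (θ n + 1) = θ (n + 1) := fun n => by
    simp only [hθ, pow_succ]
    linear_combination -hκN
  set J : ℕ → ℝ := fun n => ∫ y, η y ^ θ n * logProfile a (u y) ^ (κ ^ n) with hJ
  have hpos : ∀ n y, 0 ≤ η y ^ θ n * logProfile a (u y) ^ (κ ^ n) := fun n y => by
    by_cases hy : y ∈ Ω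
    · exact mul_nonneg (rpow_nonneg (hη0 y) _) (rpow_nonneg (by linarith [hL y hy]) _)
    · simp [hηz y hy, zero_rpow (by linarith [hθ1 n] : θ n ≠ 0)]
  have hJ0 : ∀ n, 0 ≤ J n := fun n => integral_nonneg (hpos n)
  have hJrec : ∀ n, J (n + 1) ≤ (C * (N + 1 + p) ^ p * (κ * κ ^ p) ^ n * J n) ^ κ := by
    intro n
    have h1 := hstep Ω u η a (θ n) (κ ^ n) hΩ hu hu0 hw hη hηc hηs hη0 hηK ha (hθ1 n) (hκn n)
    rw [hθs, ← pow_succ'] at h1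
    refine h1.trans (rpow_le_rpow ?_ ?_ (by linarith))
    · have := hJ0 n
      have := hθ1 n
      have h3 : 0 ≤ θ n + p := by linarith
      positivity
    · refine mul_le_mul_of_nonneg_right ?_ (hJ0 n)
      have h2 : (θ n + p) ^ p ≤ (κ ^ p) ^ n * (N + 1 + p) ^ p := by
        have h3 : θ n + p ≤ κ ^ n * (N + 1 + p) := by
          have := hκn n
          simp only [hθ]
          nlinarith
        calc (θ n + p) ^ p ≤ (κ ^ n * (N + 1 + p)) ^ p :=
              rpow_le_rpow (by linarith [hθ1 n]) h3 (by linarith)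
          _ = _ := by
            rw [mul_rpow (by positivity) (by positivity), ← rpow_natCast_mul (by linarith),
              mul_comm (n : ℝ), rpow_mul_natCast (by linarith)]
      calc C * (κ ^ n * (θ n + p) ^ p) ≤ C * (κ ^ n * ((κ ^ p) ^ n * (N + 1 + p) ^ p)) := by
            gcongr
        _ = _ := by rw [mul_pow]; ring
  have hJle := hiter J hJ0 hJrec
  have hJzero : J 0 = ∫ y, η y * logProfile a (u y) := by
    simp [hJ, hθ]
  rw [← hJzero]
  by_contra! hlt
  obtain ⟨T', hT'1, hT'2⟩ := exists_between hlt
  have hTJ : 0 ≤ T * J 0 := mul_nonneg hT.le (hJ0 0)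
  have hT'0 : 0 < T' := by linarith
  have hxΩ : x ∈ Ω := by
    by_contra h
    have := hx.self_of_nhds
    rw [hηz x h] at this
    exact zero_ne_one this
  have hLcont : ContinuousOn (fun y => logProfile a (u y)) Ω :=
    ((contDiffOn_logProfile ha).comp hu hu0).continuousOn
  have hev : ∀ᶠ y in 𝓝 x, η y = 1 ∧ T' ≤ logProfile a (u y) :=
    hx.and (((hLcont.continuousAt (hΩ.mem_nhds hxΩ)).eventually (lt_mem_nhds hT'2)).mono
      fun y hy => hy.le)
  obtain ⟨r, hr, hball⟩ := Metric.eventually_nhds_iff_ball.1 hev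
  set V := volume.real (Metric.ball x r)
  have hV : 0 < V := ENNReal.toReal_pos (Metric.measure_ball_pos volume x hr).ne'
    measure_ball_lt_top.ne
  have hlow : ∀ n, V ≤ (T * J 0 / T') ^ (κ ^ n) := by
    intro n
    have hint : Integrable fun y => η y ^ θ n * logProfile a (u y) ^ (κ ^ n) := by
      have := hθ1 n
      refine ContinuousOn.integrable_of_eq_zero (Ω := Ω) ?_ hΩ hηc hηs fun x hx => ?_
      · exact (hη.continuous.continuousOn.rpow_const fun x _ => Or.inr (by linarith)).mul
          (hLcont.rpow_const fun y hy => Or.inl (by linarith [hL y hy]))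
      · simp [hx, zero_rpow (by linarith : θ n ≠ 0)]
    have h1 : V * T' ^ (κ ^ n) ≤ J n := by
      calc V * T' ^ (κ ^ n) = ∫ y in Metric.ball x r, T' ^ (κ ^ n) := by
            simp [V]
        _ ≤ ∫ y in Metric.ball x r, η y ^ θ n * logProfile a (u y) ^ (κ ^ n) := by
            refine setIntegral_mono_on (integrableOn_const measure_ball_lt_top.ne)
              hint.integrableOn measurableSet_ball fun y hy => ?_
            obtain ⟨h1, h2⟩ := hball y hy
            rw [h1, one_rpow, one_mul]
            exact rpow_le_rpow hT'0.le h2 (by positivity)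
        _ ≤ J n := setIntegral_le_integral hint (ae_of_all _ (hpos n))
    rw [div_rpow hTJ hT'0.le, le_div_iff₀ (by positivity)]
    exact h1.trans (hJle n)
  have hlim : Tendsto (fun n : ℕ => (T * J 0 / T') ^ (κ ^ n)) atTop (𝓝 0) :=
    (tendsto_rpow_atTop_of_base_lt_one _ (by linarith [div_nonneg hTJ hT'0.le])
      ((div_lt_one hT'0).2 hT'1)).comp (tendsto_pow_atTop_atTop_of_one_lt hκ1)
  linarith [ge_of_tendsto' hlim hlow]

end Moser

section Poincare

open scoped ENNReal

variable {E : Type*} [NormedAddCommGroup E] [InnerProductSpace ℝ E]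
  [MeasurableSpace E] [BorelSpace E] [FiniteDimensional ℝ E]

lemma lintegral_comp_add_smul (g : E → ℝ≥0∞) (hg : Measurable g) (c : E) {t : ℝ} (ht : 0 < t) :
    ∫⁻ y, g (c + t • y) = ENNReal.ofReal ((t ^ Module.finrank ℝ E)⁻¹) * ∫⁻ y, g y := by
  have h1 : ∫⁻ y, g (c + t • y) = ∫⁻ y, g (c + y) ∂(Measure.map (t • ·) volume) :=
    (lintegral_map (hg.comp (measurable_const_add c)) (measurable_const_smul t)).symm
  rw [h1, Measure.map_addHaar_smul _ ht.ne', lintegral_smul_measure, lintegral_add_left_eq_self,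
    abs_of_pos (by positivity), smul_eq_mul]

lemma lintegral_comp_add_smul_le (g : E → ℝ≥0∞) (hg : Measurable g) (c : E) {t : ℝ}
    (ht : 1 / 2 ≤ t) :
    ∫⁻ y, g (c + t • y) ≤ 2 ^ Module.finrank ℝ E * ∫⁻ y, g y := by
  have ht0 : 0 < t := by linarith
  rw [lintegral_comp_add_smul g hg c ht0]
  gcongr
  rw [← inv_pow, ENNReal.ofReal_pow (by positivity)]
  gcongr
  rw [ENNReal.ofReal_le_iff_le_toReal (by simp)]
  simpa using inv_anti₀ (by norm_num) ht

lemma lintegral_lintegral_lineMap_le (g : E → ℝ≥0∞) (hg : Measurable g) (s : Set E) (t : ℝ) :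
    ∫⁻ x in s, ∫⁻ y in s, g ((1 - t) • x + t • y) ≤
      2 ^ Module.finrank ℝ E * volume s * ∫⁻ y, g y := by
  have key : ∀ r : ℝ, 1 / 2 ≤ r → ∫⁻ x in s, ∫⁻ y in s, g ((1 - r) • x + r • y) ≤
      2 ^ Module.finrank ℝ E * volume s * ∫⁻ y, g y := fun r hr => by
    calc _ ≤ ∫⁻ x in s, 2 ^ Module.finrank ℝ E * ∫⁻ y, g y := by
          gcongr with x
          exact (setLIntegral_le_lintegral _ _).trans (lintegral_comp_add_smul_le g hg _ hr)
      _ = _ := by rw [setLIntegral_const]; ring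
  rcases le_total (1 / 2) t with h | h
  · exact key t h
  · rw [lintegral_lintegral_swap (by fun_prop)]
    convert key (1 - t) (by linarith) using 6
    rw [add_comm]
    simp

/-- An `L¹` Poincaré inequality on balls. -/
lemma lintegral_lintegral_enorm_sub_le {f : E → ℝ} {Ω : Set E} {x₀ : E} {R : ℝ} (hΩ : IsOpen Ω)
    (hf : ContDiffOn ℝ 1 f Ω) (hB : Metric.ball x₀ R ⊆ Ω) :
    ∫⁻ x in Metric.ball x₀ R, ∫⁻ y in Metric.ball x₀ R, ‖f y - f x‖ₑ ≤
      ENNReal.ofReal (2 * R) * (2 ^ Module.finrank ℝ E * volume (Metric.ball x₀ R)) *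
        ∫⁻ x in Metric.ball x₀ R, ‖fderiv ℝ f x‖ₑ := by
  set B := Metric.ball x₀ R
  set g : E → ℝ≥0∞ := B.indicator fun x => ‖fderiv ℝ f x‖ₑ
  have hg : Measurable g := (measurable_fderiv ℝ f).enorm.indicator measurableSet_ball
  have hseg : ∀ x ∈ B, ∀ y ∈ B, ‖f y - f x‖ₑ ≤
      ∫⁻ t in Set.Icc (0 : ℝ) 1, ENNReal.ofReal (2 * R) * g ((1 - t) • x + t • y) := by
    intro x hx y hy
    set γ : ℝ → E := fun t => (1 - t) • x + t • y
    have hγB : ∀ t ∈ Set.Icc (0 : ℝ) 1, γ t ∈ B := fun t ht =>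
      (convex_ball x₀ R) hx hy (by linarith [ht.2]) ht.1 (by ring)
    have hγ : ContDiff ℝ 1 γ := by fun_prop
    have hγ' : ∀ t, HasDerivAt γ (y - x) t := fun t => by
      have h := (((hasDerivAt_id t).const_sub 1).smul_const x).add
        ((hasDerivAt_id t).smul_const y)
      exact h.congr_deriv (by rw [neg_one_smul, one_smul]; abel)
    have hcd : ContDiffOn ℝ 1 (f ∘ γ) (Set.Icc 0 1) :=
      hf.comp hγ.contDiffOn fun t ht => hB (hγB t ht)
    have h1 := enorm_sub_le_lintegral_deriv_of_contDiffOn_Icc hcd zero_le_one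
    have h2 : ‖f y - f x‖ₑ = ‖(f ∘ γ) 1 - (f ∘ γ) 0‖ₑ := by simp [γ]
    rw [h2]
    refine h1.trans (setLIntegral_mono' measurableSet_Icc fun t ht => ?_)
    have hd := ((hf.differentiableOn one_ne_zero).differentiableAt
      (hΩ.mem_nhds (hB (hγB t ht)))).hasFDerivAt.comp_hasDerivAt t (hγ' t)
    rw [hd.deriv]
    have hgt : g ((1 - t) • x + t • y) = ‖fderiv ℝ f (γ t)‖ₑ :=
      Set.indicator_of_mem (hγB t ht) _
    rw [hgt, mul_comm]
    refine (ContinuousLinearMap.le_opENorm _ _).trans ?_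
    gcongr
    rw [← ofReal_norm]
    refine ENNReal.ofReal_le_ofReal ?_
    rw [← dist_eq_norm]
    have := dist_triangle_right y x x₀
    have h3 := Metric.mem_ball.1 hx
    have h4 := Metric.mem_ball.1 hy
    linarith
  calc _ ≤ ∫⁻ x in B, ∫⁻ y in B, ∫⁻ t in Set.Icc (0 : ℝ) 1,
          ENNReal.ofReal (2 * R) * g ((1 - t) • x + t • y) :=
        setLIntegral_mono' measurableSet_ball fun x hx =>
          setLIntegral_mono' measurableSet_ball fun y hy => hseg x hx y hy
    _ = ∫⁻ x in B, ∫⁻ t in Set.Icc (0 : ℝ) 1, ∫⁻ y in B,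
          ENNReal.ofReal (2 * R) * g ((1 - t) • x + t • y) := by
        refine lintegral_congr fun x => lintegral_lintegral_swap ?_
        fun_prop
    _ = ∫⁻ t in Set.Icc (0 : ℝ) 1, ∫⁻ x in B, ∫⁻ y in B,
          ENNReal.ofReal (2 * R) * g ((1 - t) • x + t • y) := by
        refine lintegral_lintegral_swap ?_
        have : Measurable fun z : (E × ℝ) × E =>
          ENNReal.ofReal (2 * R) * g ((1 - z.1.2) • z.1.1 + z.1.2 • z.2) := by fun_prop
        exact this.lintegral_prod_right'.aemeasurable
    _ ≤ ∫⁻ t in Set.Icc (0 : ℝ) 1, ENNReal.ofReal (2 * R) *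
          (2 ^ Module.finrank ℝ E * volume B * ∫⁻ y, g y) := by
        refine lintegral_mono fun t => ?_
        have : ∀ x : E, ∫⁻ y in B, ENNReal.ofReal (2 * R) * g ((1 - t) • x + t • y) =
            ENNReal.ofReal (2 * R) * ∫⁻ y in B, g ((1 - t) • x + t • y) := fun x =>
          lintegral_const_mul' _ _ ENNReal.ofReal_ne_top
        simp_rw [this]
        rw [lintegral_const_mul' _ _ ENNReal.ofReal_ne_top]
        gcongr
        exact lintegral_lintegral_lineMap_le g hg B t
    _ = _ := by
        rw [setLIntegral_const, Real.volume_Icc, lintegral_indicator measurableSet_ball]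
        simp [B, mul_assoc]

/-- A nonnegative function which is at most `2` on `S` has its integral over a ball controlled
by its gradient and the measure of `S`. -/
lemma measure_mul_lintegral_le {f : E → ℝ} {Ω S : Set E} {x₀ : E} {R : ℝ} (hΩ : IsOpen Ω)
    (hf : ContDiffOn ℝ 1 f Ω) (hB : Metric.ball x₀ R ⊆ Ω) (hS : MeasurableSet S)
    (hSB : S ⊆ Metric.ball x₀ R) (hfS : ∀ x ∈ S, f x ≤ 2) :
    volume S * ∫⁻ y in Metric.ball x₀ R, ENNReal.ofReal (f y) ≤
      ENNReal.ofReal (2 * R) * (2 ^ Module.finrank ℝ E * volume (Metric.ball x₀ R)) *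
        (∫⁻ x in Metric.ball x₀ R, ‖fderiv ℝ f x‖ₑ) +
      2 * volume (Metric.ball x₀ R) * volume S := by
  set B := Metric.ball x₀ R
  calc volume S * ∫⁻ y in B, ENNReal.ofReal (f y)
      = ∫⁻ x in S, ∫⁻ y in B, ENNReal.ofReal (f y) := by rw [setLIntegral_const, mul_comm]
    _ ≤ ∫⁻ x in S, ((∫⁻ y in B, ‖f y - f x‖ₑ) + 2 * volume B) := by
        refine setLIntegral_mono' hS fun x hx => ?_
        rw [← setLIntegral_const, ← lintegral_add_right _ measurable_const]
        refine lintegral_mono fun y => ?_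
        rw [← ofReal_norm]
        calc ENNReal.ofReal (f y) ≤ ENNReal.ofReal (‖f y - f x‖ + 2) := by
              refine ENNReal.ofReal_le_ofReal ?_
              have := Real.le_norm_self (f y - f x)
              linarith [hfS x hx]
          _ = _ := by rw [ENNReal.ofReal_add (norm_nonneg _) zero_le_two]; simp
    _ = (∫⁻ x in S, ∫⁻ y in B, ‖f y - f x‖ₑ) + 2 * volume B * volume S := by
        rw [lintegral_add_right _ measurable_const, setLIntegral_const]
    _ ≤ _ := by
        gcongr
        exact (lintegral_mono_set hSB).trans (lintegral_lintegral_enorm_sub_le hΩ hf hB)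

end Poincare

section LocalGrowth

open scoped ENNReal

lemma exists_cutoff {E : Type*} [NormedAddCommGroup E] [InnerProductSpace ℝ E] [CompleteSpace E]
    [FiniteDimensional ℝ E] (x₀ : E) {r s : ℝ} (hr : 0 < r) (hrs : r < s) :
    ∃ (η : E → ℝ) (K : ℝ), 0 ≤ K ∧ ContDiff ℝ 1 η ∧ HasCompactSupport η ∧
      tsupport η ⊆ Metric.closedBall x₀ s ∧ (∀ x, 0 ≤ η x) ∧ (∀ x, η x ≤ 1) ∧
      (∀ x, ‖gradient η x‖ ≤ K) ∧ ∀ x ∈ Metric.closedBall x₀ r, η x = 1 := by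
  let η : ContDiffBump x₀ := ⟨r, s, hr, hrs⟩
  have hη : ContDiff ℝ 1 η := η.contDiff
  obtain ⟨K, hK⟩ := (η.hasCompactSupport.mono' (f' := gradient η)
    (subset_closure.trans (tsupport_gradient_subset _))).exists_bound_of_continuous
    hη.continuous_gradient
  exact ⟨η, K, (norm_nonneg _).trans (hK x₀), hη, η.hasCompactSupport, η.tsupport_eq.subset,
    fun x => η.nonneg, fun x => η.le_one, hK, fun x hx => η.one_of_mem_closedBall hx⟩

variable {E : Type*} [NormedAddCommGroup E] [InnerProductSpace ℝ E] [CompleteSpace E]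
  [MeasurableSpace E] [BorelSpace E] [FiniteDimensional ℝ E]

/-- The two bounds furnished by testing a supersolution with `η ^ p * u ^ (1 - p)`. -/
lemma exists_integral_le {p : ℝ} (hp : 1 < p) {Ω : Set E} {η : E → ℝ} {K : ℝ} (hΩ : IsOpen Ω)
    (hK : 0 ≤ K) (hη : ContDiff ℝ 1 η) (hηc : HasCompactSupport η) (hηs : tsupport η ⊆ Ω)
    (hη0 : ∀ x, 0 ≤ η x) (hηK : ∀ x, ‖gradient η x‖ ≤ K) :
    ∃ D : ℝ, 0 < D ∧ ∀ (u : E → ℝ) (k : ℝ) (A : Set E), ContDiffOn ℝ 1 u Ω →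
      (∀ x ∈ Ω, 0 < u x) → IsWeakPSupersolution p u k A Ω →
      k * (∫ x in A, η x ^ (1 + p) * u x ^ (1 - p)) +
        (p - 1) / 2 * (∫ x, η x ^ (2 : ℝ) * (‖gradient u x‖ / u x)) ≤ D := by
  obtain ⟨C, hC, h⟩ := exists_caccioppoli (E := E) hp hK
  have hI : 0 ≤ ∫ x, η x := integral_nonneg hη0
  refine ⟨C * (1 + p) ^ p * (∫ x, η x) + 1, by positivity, fun u k A hu hu0 hw => ?_⟩
  have h1 := h Ω A k u η (fun _ => 1) 1 hΩ hu hu0 hw hη hηc hηs hη0 hηK contDiffOn_const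
    (fun _ _ => zero_le_one) (fun _ _ => by simp) le_rfl
  simp only [mul_one, rpow_one, one_add_one_eq_two] at h1
  linarith

/-- A positive supersolution which is at least `a` on a set of definite measure is at least a
fixed multiple of `a` on a smaller ball. -/
lemma exists_mul_le_of_le_measure {p : ℝ} (hp : 1 < p) (hN : 2 ≤ Module.finrank ℝ E) {Ω : Set E}
    (hΩ : IsOpen Ω) {x₀ : E} {R m : ℝ} (hR : 0 < R) (hB : Metric.closedBall x₀ (2 * R) ⊆ Ω)
    (hm : 0 < m) :
    ∃ c : ℝ, 0 < c ∧ ∀ (u : E → ℝ) (a : ℝ) (S : Set E), ContDiffOn ℝ 1 u Ω →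
      (∀ x ∈ Ω, 0 < u x) → IsWeakPSupersolution p u 0 ∅ Ω → 0 < a → MeasurableSet S →
      S ⊆ Metric.ball x₀ R → (∀ x ∈ S, a ≤ u x) → ENNReal.ofReal m ≤ volume S →
      ∀ x ∈ Metric.ball x₀ (R / 2), c * a ≤ u x := by
  have hp1 : 0 < p - 1 := by linarith
  obtain ⟨η, K, hK, hη, hηc, hηs, hη0, -, hηK, hη1⟩ :=
    exists_cutoff x₀ hR (by linarith : R < 2 * R)
  obtain ⟨ζ, L, hL, hζ, hζc, hζs, hζ0, hζle, hζL, hζ1⟩ :=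
    exists_cutoff x₀ (by linarith : 0 < R / 2) (by linarith : R / 2 < 3 * R / 4)
  obtain ⟨D, hD, hcac⟩ := exists_integral_le hp hΩ hK hη hηc (hηs.trans hB) hη0 hηK
  obtain ⟨T, hT, hmoser⟩ := exists_logProfile_le (E := E) hp hL hN
  set B := Metric.ball x₀ R
  have hBΩ : B ⊆ Ω := (Metric.ball_subset_closedBall.trans
    (Metric.closedBall_subset_closedBall (by linarith))).trans hB
  have hζB : tsupport ζ ⊆ B := hζs.trans (Metric.closedBall_subset_ball (by linarith))
  set M : ℝ≥0∞ := ENNReal.ofReal (2 * R) * (2 ^ Module.finrank ℝ E * volume B) with hM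
  have hMfin : M ≠ ∞ := by
    have : volume B ≠ ∞ := measure_ball_lt_top.ne
    finiteness
  set Q : ℝ≥0∞ := M * ENNReal.ofReal (2 / (p - 1) * D) / ENNReal.ofReal m + 2 * volume B with hQ
  have hQfin : Q ≠ ∞ := by
    have : volume B ≠ ∞ := measure_ball_lt_top.ne
    have : ENNReal.ofReal m ≠ 0 := by simpa using hm
    finiteness
  refine ⟨exp (-(T * Q.toReal)), exp_pos _, fun u a S hu hu0 hw ha hS hSB hSa hSm x hx => ?_⟩
  have hgu : ContinuousOn (fun x => ‖gradient u x‖ / u x) Ω :=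
    (hu.continuousOn_gradient hΩ).norm.div hu.continuousOn fun x hx => (hu0 x hx).ne'
  set f : E → ℝ := fun x => logProfile a (u x) with hf
  have hfc : ContDiffOn ℝ 1 f Ω := (contDiffOn_logProfile ha).comp hu hu0
  have hf1 : ∀ x ∈ Ω, 1 ≤ f x := fun x hx => one_le_logProfile ha (hu0 x hx)
  have hgpos : ∀ x, 0 ≤ η x ^ (2 : ℝ) * (‖gradient u x‖ / u x) := fun x => by
    by_cases hx : x ∈ Ω
    · have := hu0 x hx
      have := hη0 x
      positivity
    · have : η x = 0 := image_eq_zero_of_notMem_tsupport fun h => hx (hB (hηs h))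
      simp [this]
  have hgi : Integrable fun x => η x ^ (2 : ℝ) * (‖gradient u x‖ / u x) :=
    ContinuousOn.integrable_of_eq_zero
      ((hη.continuous.rpow_const fun _ => Or.inr zero_le_two).continuousOn.mul hgu) hΩ hηc
      (hηs.trans hB) fun x hx => by simp [hx]
  have hgrad : ∫⁻ x in B, ‖fderiv ℝ f x‖ₑ ≤ ENNReal.ofReal (2 / (p - 1) * D) := by
    calc ∫⁻ x in B, ‖fderiv ℝ f x‖ₑ
        ≤ ∫⁻ x in B, ENNReal.ofReal (η x ^ (2 : ℝ) * (‖gradient u x‖ / u x)) := by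
          refine setLIntegral_mono' measurableSet_ball fun y hy => ?_
          have hyΩ := hBΩ hy
          have huy := hu0 y hyΩ
          have hd := (hasDerivAt_logProfile ha huy).comp_hasFDerivAt y
            ((hu.differentiableOn one_ne_zero).differentiableAt (hΩ.mem_nhds hyΩ)).hasFDerivAt
          have hd' : fderiv ℝ f y = -(a / (u y * (u y + a))) • fderiv ℝ u y := hd.fderiv
          rw [← ofReal_norm, hd', hη1 y (Metric.ball_subset_closedBall hy), one_rpow, one_mul,
            norm_smul, norm_neg, norm_gradient_eq_norm_fderiv]
          refine ENNReal.ofReal_le_ofReal ?_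
          rw [Real.norm_of_nonneg (by positivity), div_eq_inv_mul ‖fderiv ℝ u y‖]
          gcongr
          rw [div_le_iff₀ (by positivity), ← mul_assoc, inv_mul_cancel₀ huy.ne']
          linarith
      _ ≤ ∫⁻ x, ENNReal.ofReal (η x ^ (2 : ℝ) * (‖gradient u x‖ / u x)) :=
          setLIntegral_le_lintegral _ _
      _ = ENNReal.ofReal (∫ x, η x ^ (2 : ℝ) * (‖gradient u x‖ / u x)) :=
          (ofReal_integral_eq_lintegral_ofReal hgi (ae_of_all _ hgpos)).symm
      _ ≤ _ := by
          refine ENNReal.ofReal_le_ofReal ?_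
          have h1 := hcac u 0 ∅ hu hu0 hw
          rw [zero_mul, zero_add] at h1
          rw [div_mul_eq_mul_div, le_div_iff₀ hp1]
          linarith
  have hfS : ∀ x ∈ S, f x ≤ 2 := fun x hx => by
    have hux := hu0 x (hBΩ (hSB hx))
    have h1 : a / u x ≤ 1 := (div_le_one hux).2 (hSa x hx)
    have h2 : log (1 + a / u x) ≤ 1 + a / u x - 1 :=
      log_le_sub_one_of_pos (by positivity)
    simp only [hf, logProfile]
    linarith
  have hI : ∫⁻ y in B, ENNReal.ofReal (f y) ≤ Q := by
    have h1 := measure_mul_lintegral_le hΩ hfc hBΩ hS hSB hfS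
    have hS0 : volume S ≠ 0 := fun h => by
      rw [h, nonpos_iff_eq_zero, ENNReal.ofReal_eq_zero] at hSm
      linarith
    have hSfin : volume S ≠ ∞ := measure_ne_top_of_subset hSB measure_ball_lt_top.ne
    have h2 : ∫⁻ y in B, ENNReal.ofReal (f y) ≤
        (M * ENNReal.ofReal (2 / (p - 1) * D) + 2 * volume B * volume S) / volume S := by
      rw [ENNReal.le_div_iff_mul_le (Or.inl hS0) (Or.inl hSfin), mul_comm]
      exact h1.trans (add_le_add (mul_le_mul' le_rfl hgrad) le_rfl)
    refine h2.trans ?_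
    rw [ENNReal.add_div, ENNReal.mul_div_cancel_right hS0 hSfin]
    exact add_le_add (ENNReal.div_le_div_left hSm _) le_rfl
  have hζf0 : ∀ y, 0 ≤ ζ y * f y := fun y => by
    by_cases hy : y ∈ Ω
    · exact mul_nonneg (hζ0 y) (by linarith [hf1 y hy])
    · have : ζ y = 0 := image_eq_zero_of_notMem_tsupport fun h => hy (hBΩ (hζB h))
      simp [this]
  have hζi : Integrable fun y => ζ y * f y :=
    ContinuousOn.integrable_of_eq_zero (hζ.continuous.continuousOn.mul hfc.continuousOn) hΩ hζc
      (hζB.trans hBΩ) fun x hx => by simp [hx]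
  have hζI : ∫ y, ζ y * f y ≤ Q.toReal := by
    rw [integral_eq_lintegral_of_nonneg_ae (ae_of_all _ hζf0) hζi.aestronglyMeasurable]
    refine ENNReal.toReal_mono hQfin (le_trans ?_ hI)
    rw [← lintegral_indicator measurableSet_ball]
    refine lintegral_mono fun y => ?_
    by_cases hy : y ∈ B
    · rw [Set.indicator_of_mem hy]
      refine ENNReal.ofReal_le_ofReal ?_
      nlinarith [hζle y, hf1 y (hBΩ hy)]
    · have : ζ y = 0 := image_eq_zero_of_notMem_tsupport fun h => hy (hζB h)
      simp [this]
  have hxm : f x ≤ T * Q.toReal := (hmoser Ω u ζ a hΩ hu hu0 hw hζ hζc (hζB.trans hBΩ) hζ0 hζL ha x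
    (by filter_upwards [Metric.isOpen_ball.mem_nhds hx] with y hy using
        hζ1 y (Metric.ball_subset_closedBall hy))).trans (by gcongr)
  have hux : 0 < u x := hu0 x (hBΩ (Metric.ball_subset_ball (by linarith) hx))
  have hau : a / u x ≤ exp (T * Q.toReal) := by
    have h1 : log (1 + a / u x) ≤ T * Q.toReal := by
      simp only [hf, logProfile] at hxm
      linarith
    have h2 := (log_le_iff_le_exp (by positivity)).1 h1
    linarith
  rw [div_le_iff₀ hux] at hau
  rw [Real.exp_neg, inv_mul_le_iff₀ (exp_pos _)]
  exact hau

/-- If `-Δ_p u ≥ k` on a set of definite measure inside a ball, then `u` is at least a fixed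
multiple of `k ^ (1 / (p - 1))` on a smaller ball. -/
lemma exists_mul_rpow_le_of_le_measure {p : ℝ} (hp : 1 < p) (hN : 2 ≤ Module.finrank ℝ E)
    {Ω : Set E} (hΩ : IsOpen Ω) {x₀ : E} {R m : ℝ} (hR : 0 < R)
    (hB : Metric.closedBall x₀ (2 * R) ⊆ Ω) (hm : 0 < m) :
    ∃ c : ℝ, 0 < c ∧ ∀ (u : E → ℝ) (k : ℝ) (A : Set E), ContDiffOn ℝ 1 u Ω →
      (∀ x ∈ Ω, 0 < u x) → IsWeakPSupersolution p u k A Ω → 0 < k → MeasurableSet A →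
      ENNReal.ofReal m ≤ volume (A ∩ Metric.ball x₀ R) →
      ∀ x ∈ Metric.ball x₀ (R / 2), c * k ^ (1 / (p - 1)) ≤ u x := by
  have hp1 : 0 < p - 1 := by linarith
  obtain ⟨η, K, hK, hη, hηc, hηs, hη0, -, hηK, hη1⟩ :=
    exists_cutoff x₀ hR (by linarith : R < 2 * R)
  obtain ⟨D, hD, hcac⟩ := exists_integral_le hp hΩ hK hη hηc (hηs.trans hB) hη0 hηK
  obtain ⟨c, hc, hloc⟩ := exists_mul_le_of_le_measure hp hN hΩ hR hB (half_pos hm)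
  set B := Metric.ball x₀ R
  have hBΩ : B ⊆ Ω := (Metric.ball_subset_closedBall.trans
    (Metric.closedBall_subset_closedBall (by linarith))).trans hB
  set b : ℝ := (m / 2 / D) ^ (1 / (p - 1))
  have hb : 0 < b := by positivity
  refine ⟨c * b, by positivity, fun u k A hu hu0 hw hk hA hAm x hx => ?_⟩
  set a : ℝ := b * k ^ (1 / (p - 1)) with ha
  have ha0 : 0 < a := by positivity
  have hap : k * a ^ (1 - p) = D / (m / 2) := by
    have h1 : a ^ (p - 1) = m / 2 / D * k := by
      rw [ha, mul_rpow hb.le (by positivity), ← rpow_mul (by positivity), ← rpow_mul hk.le,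
        one_div_mul_cancel hp1.ne', rpow_one, rpow_one]
    rw [show 1 - p = -(p - 1) by ring, rpow_neg ha0.le, h1]
    field_simp
  rw [mul_assoc]
  set W := A ∩ (B ∩ u ⁻¹' Set.Iio a) with hW
  have hWopen : IsOpen (B ∩ u ⁻¹' Set.Iio a) :=
    (hu.continuousOn.mono hBΩ).isOpen_inter_preimage Metric.isOpen_ball isOpen_Iio
  have hWm : MeasurableSet W := hA.inter hWopen.measurableSet
  have hWfin : volume W ≠ ∞ :=
    measure_ne_top_of_subset (Set.inter_subset_right.trans Set.inter_subset_left)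
      measure_ball_lt_top.ne
  have hpos : ∀ x, 0 ≤ η x ^ (1 + p) * u x ^ (1 - p) := fun x => by
    by_cases hx : x ∈ Ω
    · have := hu0 x hx
      have := hη0 x
      positivity
    · have : η x = 0 := image_eq_zero_of_notMem_tsupport fun h => hx (hB (hηs h))
      simp [this, zero_rpow (by linarith : 1 + p ≠ 0)]
  have hint : Integrable fun x => η x ^ (1 + p) * u x ^ (1 - p) :=
    ContinuousOn.integrable_of_eq_zero
      ((hη.continuous.rpow_const fun _ => Or.inr (by linarith)).continuousOn.mul
        (hu.continuousOn.rpow_const fun x hx => Or.inl (hu0 x hx).ne')) hΩ hηc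
      (hηs.trans hB) fun x hx => by simp [hx, zero_rpow (by linarith : 1 + p ≠ 0)]
  have hWle : volume.real W ≤ m / 2 := by
    have h1 : volume.real W * a ^ (1 - p) ≤ ∫ x in A, η x ^ (1 + p) * u x ^ (1 - p) := by
      calc volume.real W * a ^ (1 - p) = ∫ x in W, a ^ (1 - p) := by simp
        _ ≤ ∫ x in W, η x ^ (1 + p) * u x ^ (1 - p) := by
          refine setIntegral_mono_on (integrableOn_const hWfin) hint.integrableOn hWm
            fun y hy => ?_
          rw [hη1 y (Metric.ball_subset_closedBall hy.2.1), one_rpow, one_mul]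
          exact rpow_le_rpow_of_nonpos (hu0 y (hBΩ hy.2.1)) (le_of_lt hy.2.2) (by linarith)
        _ ≤ _ := setIntegral_mono_set hint.integrableOn (ae_of_all _ hpos)
          (LE.le.eventuallyLE Set.inter_subset_left)
    have h2 := hcac u k A hu hu0 hw
    have h3 : 0 ≤ ∫ x, η x ^ (2 : ℝ) * (‖gradient u x‖ / u x) := integral_nonneg fun x => by
      by_cases hx : x ∈ Ω
      · have := hu0 x hx
        have := hη0 x
        positivity
      · have : η x = 0 := image_eq_zero_of_notMem_tsupport fun h => hx (hB (hηs h))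
        simp [this]
    have h4 : volume.real W * (D / (m / 2)) ≤ D := by
      rw [← hap]
      nlinarith
    rw [← mul_div_assoc, div_le_iff₀ (half_pos hm), mul_comm] at h4
    exact le_of_mul_le_mul_left h4 hD
  refine hloc u a ((A ∩ B) \ W) hu hu0 (hw.zero_left hk.le) ha0
    ((hA.inter measurableSet_ball).diff hWm) (Set.sdiff_subset.trans Set.inter_subset_right)
    (fun y hy => ?_) ?_ x hx
  · by_contra! h
    exact hy.2 ⟨hy.1.1, hy.1.2, h⟩
  · have h1 : volume (A ∩ B) ≤ volume ((A ∩ B) \ W) + volume W :=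
      (measure_mono (by rw [Set.sdiff_union_self]; exact Set.subset_union_left)).trans
        (measure_union_le _ _)
    have h2 : volume W ≤ ENNReal.ofReal (m / 2) := by
      rwa [ENNReal.le_ofReal_iff_toReal_le hWfin (by positivity)]
    have h3 : ENNReal.ofReal (m / 2) + ENNReal.ofReal (m / 2) ≤
        volume ((A ∩ B) \ W) + ENNReal.ofReal (m / 2) := by
      rw [← ENNReal.ofReal_add (by positivity) (by positivity), add_halves]
      exact hAm.trans (h1.trans (by gcongr))
    exact (ENNReal.add_le_add_iff_right ENNReal.ofReal_ne_top).1 h3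

end LocalGrowth

section Chaining

open scoped ENNReal

variable {E : Type*} [NormedAddCommGroup E] [InnerProductSpace ℝ E] [CompleteSpace E]
  [MeasurableSpace E] [BorelSpace E] [FiniteDimensional ℝ E]

/-- Positivity of `p`-supersolutions propagates from any neighbourhood of `x` to a neighbourhood
of `y`, in a quantitative way. -/
def PropagatesPositivity (p : ℝ) (Ω : Set E) (x y : E) : Prop :=
  ∀ ε > 0, ∃ c > 0, ∃ δ > 0, ∀ (u : E → ℝ) (a : ℝ), ContDiffOn ℝ 1 u Ω → (∀ z ∈ Ω, 0 < u z) →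
    IsWeakPSupersolution p u 0 ∅ Ω → 0 < a → (∀ z ∈ Metric.ball x ε, a ≤ u z) →
    ∀ z ∈ Metric.ball y δ, c * a ≤ u z

lemma PropagatesPositivity.trans {p : ℝ} {Ω : Set E} {x y z : E}
    (hxy : PropagatesPositivity p Ω x y) (hyz : PropagatesPositivity p Ω y z) :
    PropagatesPositivity p Ω x z := by
  intro ε hε
  obtain ⟨c₁, hc₁, δ₁, hδ₁, h₁⟩ := hxy ε hε
  obtain ⟨c₂, hc₂, δ₂, hδ₂, h₂⟩ := hyz δ₁ hδ₁
  refine ⟨c₂ * c₁, mul_pos hc₂ hc₁, δ₂, hδ₂, fun u a hu hu0 hw ha hx w hwz => ?_⟩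
  rw [mul_assoc]
  exact h₂ u (c₁ * a) hu hu0 hw (mul_pos hc₁ ha) (h₁ u a hu hu0 hw ha hx) w hwz

lemma exists_closedBall_two_mul_subset {X : Type*} [PseudoMetricSpace X] {Ω : Set X}
    (hΩ : IsOpen Ω) {x : X} (hx : x ∈ Ω) : ∃ R > 0, Metric.closedBall x (2 * R) ⊆ Ω := by
  obtain ⟨r, hr, h⟩ := Metric.nhds_basis_closedBall.mem_iff.1 (hΩ.mem_nhds hx)
  exact ⟨r / 2, half_pos hr, by rwa [mul_div_cancel₀ _ two_ne_zero]⟩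

lemma propagatesPositivity_of_mem_ball {p : ℝ} (hp : 1 < p) (hN : 2 ≤ Module.finrank ℝ E)
    {Ω : Set E} (hΩ : IsOpen Ω) {x₀ y z : E} {R : ℝ} (hR : 0 < R)
    (hB : Metric.closedBall x₀ (2 * R) ⊆ Ω) (hy : y ∈ Metric.ball x₀ (R / 2))
    (hz : z ∈ Metric.ball x₀ (R / 2)) : PropagatesPositivity p Ω y z := by
  intro ε hε
  set S := Metric.ball y ε ∩ Metric.ball x₀ R
  have hSo : IsOpen S := Metric.isOpen_ball.inter Metric.isOpen_ball
  have hS0 : 0 < volume S := hSo.measure_pos volume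
    ⟨y, Metric.mem_ball_self hε, Metric.ball_subset_ball (by linarith) hy⟩
  have hSfin : volume S ≠ ∞ :=
    measure_ne_top_of_subset Set.inter_subset_right measure_ball_lt_top.ne
  obtain ⟨c, hc, h⟩ := exists_mul_le_of_le_measure hp hN hΩ hR hB
    (ENNReal.toReal_pos hS0.ne' hSfin)
  obtain ⟨δ, hδ, hδB⟩ := Metric.isOpen_iff.1 Metric.isOpen_ball z hz
  exact ⟨c, hc, δ, hδ, fun u a hu hu0 hw ha hya w hwz => h u a S hu hu0 hw ha hSo.measurableSet
    Set.inter_subset_right (fun v hv => hya v hv.1) (ENNReal.ofReal_toReal_le) w (hδB hwz)⟩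

lemma propagatesPositivity_of_isPreconnected {p : ℝ} (hp : 1 < p)
    (hN : 2 ≤ Module.finrank ℝ E) {Ω : Set E} (hΩ : IsOpen Ω) (hΩc : IsPreconnected Ω) {x y : E}
    (hx : x ∈ Ω) (hy : y ∈ Ω) : PropagatesPositivity p Ω x y := by
  refine hΩc.induction₂' (PropagatesPositivity p Ω) (fun z hz => ?_)
    (fun _ _ _ _ _ _ h₁ h₂ => h₁.trans h₂) hx hy
  obtain ⟨R, hR, hB⟩ := exists_closedBall_two_mul_subset hΩ hz
  have hzz := Metric.mem_ball_self (x := z) (half_pos hR)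
  filter_upwards [mem_nhdsWithin_of_mem_nhds (Metric.isOpen_ball.mem_nhds hzz)] with w hw
  exact ⟨propagatesPositivity_of_mem_ball hp hN hΩ hR hB hzz hw,
    propagatesPositivity_of_mem_ball hp hN hΩ hR hB hw hzz⟩

/-- In a connected open set, positivity on a ball propagates to any compact set. -/
lemma exists_mul_le_of_isCompact {p : ℝ} (hp : 1 < p) (hN : 2 ≤ Module.finrank ℝ E) {Ω K : Set E}
    (hΩ : IsOpen Ω) (hΩc : IsPreconnected Ω) (hK : IsCompact K) (hKΩ : K ⊆ Ω) {x : E}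
    (hx : x ∈ Ω) {ε : ℝ} (hε : 0 < ε) :
    ∃ c > 0, ∀ (u : E → ℝ) (a : ℝ), ContDiffOn ℝ 1 u Ω → (∀ z ∈ Ω, 0 < u z) →
      IsWeakPSupersolution p u 0 ∅ Ω → 0 < a → (∀ z ∈ Metric.ball x ε, a ≤ u z) →
      ∀ z ∈ K, c * a ≤ u z := by
  refine hK.induction_on (p := fun s => ∃ c > 0, ∀ (u : E → ℝ) (a : ℝ), ContDiffOn ℝ 1 u Ω →
      (∀ z ∈ Ω, 0 < u z) → IsWeakPSupersolution p u 0 ∅ Ω → 0 < a →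
      (∀ z ∈ Metric.ball x ε, a ≤ u z) → ∀ z ∈ s, c * a ≤ u z) ?_ ?_ ?_ ?_
  · exact ⟨1, one_pos, by simp⟩
  · rintro s t hst ⟨c, hc, h⟩
    exact ⟨c, hc, fun u a hu hu0 hw ha hx z hz => h u a hu hu0 hw ha hx z (hst hz)⟩
  · rintro s t ⟨c, hc, h⟩ ⟨d, hd, h'⟩
    refine ⟨min c d, lt_min hc hd, fun u a hu hu0 hw ha hx z hz => ?_⟩
    rcases hz with hz | hz
    · exact (mul_le_mul_of_nonneg_right (min_le_left c d) ha.le).trans (h u a hu hu0 hw ha hx z hz)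
    · exact (mul_le_mul_of_nonneg_right (min_le_right c d) ha.le).trans
        (h' u a hu hu0 hw ha hx z hz)
  · intro y hy
    obtain ⟨c, hc, δ, hδ, h⟩ :=
      propagatesPositivity_of_isPreconnected hp hN hΩ hΩc hx (hKΩ hy) ε hε
    exact ⟨Metric.ball y δ, mem_nhdsWithin_of_mem_nhds (Metric.ball_mem_nhds y hδ), c, hc, h⟩

lemma exists_mul_rpow_le_of_le_measure_inter {p : ℝ} (hp : 1 < p)
    (hN : 2 ≤ Module.finrank ℝ E) {Ω K L : Set E} (hΩ : IsOpen Ω) (hΩc : IsPreconnected Ω)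
    (hK : IsCompact K) (hKΩ : K ⊆ Ω) (hL : IsCompact L) (hLΩ : L ⊆ Ω) :
    ∀ m > 0, ∃ c > 0, ∀ (u : E → ℝ) (k : ℝ) (A : Set E), ContDiffOn ℝ 1 u Ω →
      (∀ z ∈ Ω, 0 < u z) → IsWeakPSupersolution p u k A Ω → 0 < k → MeasurableSet A →
      ENNReal.ofReal m ≤ volume (A ∩ L) → ∀ z ∈ K, c * k ^ (1 / (p - 1)) ≤ u z := by
  refine hL.induction_on (p := fun s => ∀ m > 0, ∃ c > 0, ∀ (u : E → ℝ) (k : ℝ) (A : Set E),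
      ContDiffOn ℝ 1 u Ω → (∀ z ∈ Ω, 0 < u z) → IsWeakPSupersolution p u k A Ω → 0 < k →
      MeasurableSet A → ENNReal.ofReal m ≤ volume (A ∩ s) →
      ∀ z ∈ K, c * k ^ (1 / (p - 1)) ≤ u z) ?_ ?_ ?_ ?_
  · intro m hm
    refine ⟨1, one_pos, fun u k A _ _ _ _ _ hA => ?_⟩
    simp at hA
    linarith
  · intro s t hst h m hm
    obtain ⟨c, hc, h⟩ := h m hm
    exact ⟨c, hc, fun u k A hu hu0 hw hk hA hAs => h u k A hu hu0 hw hk hA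
      (hAs.trans (measure_mono (Set.inter_subset_inter_right A hst)))⟩
  · intro s t hs ht m hm
    obtain ⟨c, hc, h⟩ := hs (m / 2) (half_pos hm)
    obtain ⟨d, hd, h'⟩ := ht (m / 2) (half_pos hm)
    refine ⟨min c d, lt_min hc hd, fun u k A hu hu0 hw hk hA hAst z hz => ?_⟩
    have hk' : 0 ≤ k ^ (1 / (p - 1)) := rpow_nonneg hk.le _
    by_cases hAs : ENNReal.ofReal (m / 2) ≤ volume (A ∩ s)
    · exact (mul_le_mul_of_nonneg_right (min_le_left c d) hk').trans
        (h u k A hu hu0 hw hk hA hAs z hz)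
    by_cases hAt : ENNReal.ofReal (m / 2) ≤ volume (A ∩ t)
    · exact (mul_le_mul_of_nonneg_right (min_le_right c d) hk').trans
        (h' u k A hu hu0 hw hk hA hAt z hz)
    have h1 : volume (A ∩ (s ∪ t)) ≤ volume (A ∩ s) + volume (A ∩ t) := by
      rw [Set.inter_union_distrib_left]
      exact measure_union_le _ _
    have h2 := h1.trans_lt (ENNReal.add_lt_add (not_le.1 hAs) (not_le.1 hAt))
    rw [← ENNReal.ofReal_add (by positivity) (by positivity), add_halves] at h2
    exact absurd hAst (not_le.2 h2)
  · intro x hx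
    obtain ⟨R, hR, hB⟩ := exists_closedBall_two_mul_subset hΩ (hLΩ hx)
    refine ⟨Metric.ball x R, mem_nhdsWithin_of_mem_nhds (Metric.ball_mem_nhds x hR),
      fun m hm => ?_⟩
    obtain ⟨c, hc, h⟩ := exists_mul_rpow_le_of_le_measure hp hN hΩ hR hB hm
    obtain ⟨d, hd, h'⟩ :=
      exists_mul_le_of_isCompact hp hN hΩ hΩc hK hKΩ (hLΩ hx) (half_pos hR)
    refine ⟨d * c, mul_pos hd hc, fun u k A hu hu0 hw hk hA hAx => ?_⟩
    rw [mul_assoc]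
    exact h' u _ hu hu0 (hw.zero_left hk.le) (by positivity) (h u k A hu hu0 hw hk hA hAx)

/-- The growth lemma for positive weak supersolutions in a connected open set of finite
measure. -/
theorem exists_mul_rpow_le_of_isWeakPSupersolution {p m : ℝ} (hp : 1 < p)
    (hN : 2 ≤ Module.finrank ℝ E) {Ω K : Set E} (hΩ : IsOpen Ω) (hΩc : IsPreconnected Ω)
    (hΩfin : volume Ω ≠ ∞) (hK : IsCompact K) (hKΩ : K ⊆ Ω) (hm : 0 < m) :
    ∃ c > 0, ∀ (u : E → ℝ) (k : ℝ) (A : Set E), ContDiffOn ℝ 1 u Ω → (∀ z ∈ Ω, 0 < u z) →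
      IsWeakPSupersolution p u k A Ω → 0 < k → MeasurableSet A → A ⊆ Ω →
      ENNReal.ofReal m ≤ volume A → ∀ z ∈ K, c * k ^ (1 / (p - 1)) ≤ u z := by
  obtain ⟨L, hLΩ, hL, hLm⟩ := hΩ.measurableSet.exists_isCompact_lt_add hΩfin
    (ε := ENNReal.ofReal (m / 2)) (by simpa using hm)
  obtain ⟨c, hc, h⟩ := exists_mul_rpow_le_of_le_measure_inter hp hN hΩ hΩc hK hKΩ hL hLΩ
    (m / 2) (half_pos hm)
  refine ⟨c, hc, fun u k A hu hu0 hw hk hA hAΩ hAm => h u k A hu hu0 hw hk hA ?_⟩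
  have hdiff : volume (Ω \ L) ≤ ENNReal.ofReal (m / 2) := by
    rw [measure_sdiff hLΩ hL.measurableSet.nullMeasurableSet hL.measure_ne_top]
    exact tsub_le_iff_left.2 hLm.le
  have h1 : volume A ≤ volume (A ∩ L) + ENNReal.ofReal (m / 2) :=
    (measure_le_inter_add_sdiff volume A L).trans
      (by gcongr; exact (measure_mono (Set.sdiff_subset_sdiff_left hAΩ)).trans hdiff)
  have h2 := hAm.trans h1
  rw [← add_halves m, ENNReal.ofReal_add (by positivity) (by positivity), add_halves m] at h2
  exact (ENNReal.add_le_add_iff_right ENNReal.ofReal_ne_top).1 h2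

end Chaining

lemma isPreconnected_annulus {E : Type*} [NormedAddCommGroup E] [NormedSpace ℝ E]
    (hE : 1 < Module.rank ℝ E) {r s : ℝ} (hr : 0 ≤ r) :
    IsPreconnected {x : E | r < ‖x‖ ∧ ‖x‖ < s} := by
  have h := (isPreconnected_Ioo (a := r) (b := s)).prod (isPreconnected_sphere hE (0 : E) 1)
  convert h.image (fun z : ℝ × E => z.1 • z.2) (by fun_prop) using 1
  ext x
  constructor
  · rintro ⟨h₁, h₂⟩
    have hx : 0 < ‖x‖ := hr.trans_lt h₁
    exact ⟨(‖x‖, ‖x‖⁻¹ • x), ⟨⟨h₁, h₂⟩, by simp [norm_smul, hx.ne']⟩,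
      smul_inv_smul₀ hx.ne' x⟩
  · rintro ⟨⟨t, y⟩, ⟨⟨h₁, h₂⟩, hy⟩, rfl⟩
    simp only [mem_sphere_iff_norm, sub_zero] at hy h₁ h₂
    simp [norm_smul, hy, abs_of_pos (hr.trans_lt h₁), h₁, h₂]

/-- Growth lemma: for `N ≥ 2`, `p > 1`, `m > 0` there is `c₀ > 0`, depending only on
`N, p, m`, such that if `h ≥ 0` is bounded on the annulus `Ω = {1/2 < ‖x‖ < 3}`,
`A ⊆ Ω` is measurable with `volume A ≥ m`, and `u ≥ 0` is a classical supersolution of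
`-Δ_p u ≥ h` on `Ω`, then `inf {u(x) : 1 ≤ ‖x‖ ≤ 2} ≥ c₀ (inf_A h)^(1/(p-1))`. -/
theorem growth_lemma (N : ℕ) (hN : 2 ≤ N) (p : ℝ) (hp : 1 < p) (m : ℝ) (hm : 0 < m) :
    ∃ c₀ : ℝ, 0 < c₀ ∧
      ∀ (h u : EuclideanSpace ℝ (Fin N) → ℝ) (A : Set (EuclideanSpace ℝ (Fin N))),
        (∀ x : EuclideanSpace ℝ (Fin N), 1/2 < ‖x‖ → ‖x‖ < 3 → 0 ≤ h x) →
        (∃ M : ℝ, ∀ x : EuclideanSpace ℝ (Fin N), 1/2 < ‖x‖ → ‖x‖ < 3 → h x ≤ M) →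
        A ⊆ {x : EuclideanSpace ℝ (Fin N) | 1/2 < ‖x‖ ∧ ‖x‖ < 3} →
        MeasurableSet A → ENNReal.ofReal m ≤ volume A →
        (∀ x : EuclideanSpace ℝ (Fin N), 1/2 < ‖x‖ → ‖x‖ < 3 → 0 ≤ u x) →
        IsPSupersolution N p u h {x : EuclideanSpace ℝ (Fin N) | 1/2 < ‖x‖ ∧ ‖x‖ < 3} →
        ∀ x : EuclideanSpace ℝ (Fin N), 1 ≤ ‖x‖ → ‖x‖ ≤ 2 →
          c₀ * (sInf (h '' A)) ^ (1 / (p - 1)) ≤ u x := by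
  set Ω := {x : EuclideanSpace ℝ (Fin N) | 1/2 < ‖x‖ ∧ ‖x‖ < 3} with hΩdef
  set K := {x : EuclideanSpace ℝ (Fin N) | 1 ≤ ‖x‖ ∧ ‖x‖ ≤ 2}
  have hp1 : 0 < p - 1 := by linarith
  have hΩ : IsOpen Ω :=
    (isOpen_lt continuous_const continuous_norm).inter (isOpen_lt continuous_norm continuous_const)
  have hdim : 2 ≤ Module.finrank ℝ (EuclideanSpace ℝ (Fin N)) := by simpa using hN
  have hΩc : IsPreconnected Ω :=
    isPreconnected_annulus (Module.lt_rank_of_lt_finrank (by exact_mod_cast hdim)) (by norm_num)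
  have hΩfin : volume Ω ≠ ⊤ := measure_ne_top_of_subset (s := Metric.ball 0 3)
    (fun x (hx : x ∈ Ω) => mem_ball_zero_iff.2 hx.2) measure_ball_lt_top.ne
  have hK : IsCompact K := (isCompact_closedBall 0 2).of_isClosed_subset
    ((isClosed_le continuous_const continuous_norm).inter
      (isClosed_le continuous_norm continuous_const)) fun x hx => mem_closedBall_zero_iff.2 hx.2
  have hKΩ : K ⊆ Ω := fun x hx => ⟨by linarith [hx.1], by linarith [hx.2]⟩
  obtain ⟨c, hc, hgrow⟩ :=
    exists_mul_rpow_le_of_isWeakPSupersolution hp hdim hΩ hΩc hΩfin hK hKΩ hm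
  refine ⟨c, hc, fun h u A hh _ hA hAm hAvol hu hsup x hx₁ hx₂ => ?_⟩
  have hhA : ∀ y ∈ h '' A, 0 ≤ y := by
    rintro _ ⟨y, hy, rfl⟩
    exact hh y (hA hy).1 (hA hy).2
  rcases (Real.sInf_nonneg hhA).eq_or_lt with hk | hk
  · rw [← hk, zero_rpow (by positivity), mul_zero]
    exact hu x (by linarith) (by linarith)
  have hw := IsPSupersolution.isWeakPSupersolution (by linarith) hΩ hsup hAm
    (fun y hy => hh y hy.1 hy.2)
    (fun y hy => csInf_le ⟨0, hhA⟩ (Set.mem_image_of_mem h hy.1) : ∀ y ∈ A ∩ Ω, sInf (h '' A) ≤ h y)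
  refine le_of_forall_pos_le_add fun ε hε => ?_
  exact hgrow (fun y => u y + ε) _ A (hsup.1.add contDiffOn_const)
    (fun y hy => add_pos_of_nonneg_of_pos (hu y hy.1 hy.2) hε) (hw.add_const ε) hk hAm hA hAvol x
    ⟨hx₁, hx₂⟩
end

section
/- Let N ≥ 2 and p = N. Suppose u ≥ 0 is classically N-superharmonic on {x : ‖x‖ > 1} ⊆ EuclideanSpace ℝ (Fin N). Then the function ρ(r) = inf { u(x)/log(3‖x‖) : r < ‖x‖ < 2r } is bounded above on [2,∞); in particular there exists C > 0 such that m(r) = inf { u(x) : r < ‖x‖ < 2r } satisfies m(r) ≤ C·log r for all r ≥ 2. -/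
open MeasureTheory Filter Real Matrix
open scoped RealInnerProductSpace

section SecondOrder

variable {E : Type*} [NormedAddCommGroup E] [InnerProductSpace ℝ E]

/-- Along a line, the derivative at a local minimum has nonnegative second derivative. -/
theorem inner_fderiv_nonneg_of_isLocalMin [CompleteSpace E] {w : E → ℝ} {g : E → E}
    {H : E →L[ℝ] E} {x : E} (hmin : IsLocalMin w x)
    (hg : ∀ᶠ y in nhds x, HasGradientAt w (g y) y) (hH : HasFDerivAt g H x) (e : E) :
    0 ≤ ⟪H e, e⟫ := by
  set f : ℝ → ℝ := fun t => w (x + t • e) with hf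
  have hline : ∀ t : ℝ, HasDerivAt (fun t : ℝ => x + t • e) e t := fun t => by
    simpa using ((hasDerivAt_id t).smul_const e).const_add x
  have htend : Tendsto (fun t : ℝ => x + t • e) (nhds 0) (nhds x) := by
    simpa using (hline 0).continuousAt.tendsto
  have hderiv : ∀ᶠ t in nhds (0 : ℝ), HasDerivAt f ⟪g (x + t • e), e⟫ t := by
    filter_upwards [htend.eventually hg] with t ht
    simpa [hf, Function.comp_def] using ht.hasFDerivAt.comp_hasDerivAt t (hline t)
  have hderiv_eq : deriv f =ᶠ[nhds 0] fun t => ⟪g (x + t • e), e⟫ :=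
    hderiv.mono fun t ht => ht.deriv
  have hderiv2 : HasDerivAt (deriv f) ⟪H e, e⟫ 0 := by
    refine HasDerivAt.congr_of_eventuallyEq ?_ hderiv_eq
    have h0 : HasFDerivAt g H (x + (0 : ℝ) • e) := by simpa using hH
    simpa using (h0.comp_hasDerivAt 0 (hline 0)).inner ℝ (hasDerivAt_const (0 : ℝ) e)
  have hfmin : IsLocalMin f 0 := by
    have := htend.eventually hmin
    filter_upwards [this] with t ht
    simpa [hf] using ht
  by_contra! hneg
  have hfmax : IsLocalMax f 0 :=
    isLocalMax_of_deriv_deriv_neg (by rwa [hderiv2.deriv]) hfmin.deriv_eq_zero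
      hderiv.self_of_nhds.continuousAt
  have hconst : f =ᶠ[nhds 0] fun _ => f 0 := by
    filter_upwards [hfmin, hfmax] with t h1 h2 using le_antisymm h2 h1
  have : deriv (deriv f) 0 = 0 := by
    rw [hconst.deriv.deriv_eq]
    simp
  rw [hderiv2.deriv] at this
  exact hneg.ne this

/-- Derivative of `‖g‖ ^ q • g` where `g` does not vanish. -/
theorem HasFDerivAt.norm_rpow_smul_self {g : E → E} {H : E →L[ℝ] E} {x : E}
    (hH : HasFDerivAt g H x) (hx : g x ≠ 0) (q : ℝ) :
    HasFDerivAt (fun y => ‖g y‖ ^ q • g y)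
      (‖g x‖ ^ q • (H + (q / ‖g x‖ ^ 2) • ((innerSL ℝ (g x)).comp H).smulRight (g x))) x := by
  have hpos : 0 < ‖g x‖ := norm_pos_iff.mpr hx
  have hrw : ∀ z : E, (‖z‖ ^ 2) ^ (q / 2) = ‖z‖ ^ q := fun z => by
    rw [← Real.rpow_natCast, ← Real.rpow_mul (norm_nonneg z)]
    congr 1
    push_cast
    ring
  have h := (hH.norm_sq.rpow_const (p := q / 2) (Or.inl (by positivity))).smul hH
  simp only [hrw] at h
  refine h.congr_fderiv ?_
  have hexp : (‖g x‖ ^ 2) ^ (q / 2 - 1) = ‖g x‖ ^ q / ‖g x‖ ^ 2 := by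
    rw [Real.rpow_sub_one (by positivity), hrw]
  ext e
  simp only [hexp, _root_.add_apply, _root_.smul_apply,
    ContinuousLinearMap.smulRight_apply, ContinuousLinearMap.comp_apply, innerSL_apply_apply,
    smul_add, smul_smul, smul_eq_mul, nsmul_eq_mul]
  congr 2
  push_cast
  ring

theorem norm_rpow_smul_norm_rpow_smul_self {p : ℝ} (hp : 1 < p) (z : E) :
    ‖‖z‖ ^ (p - 2) • z‖ ^ ((2 - p) / (p - 1)) • (‖z‖ ^ (p - 2) • z) = z := by
  rcases eq_or_ne z 0 with rfl | hz
  · simp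
  have hpos : 0 < ‖z‖ := norm_pos_iff.mpr hz
  have hn : ‖‖z‖ ^ (p - 2) • z‖ = ‖z‖ ^ (p - 1) := by
    rw [norm_smul, Real.norm_of_nonneg (by positivity), ← Real.rpow_add_one hpos.ne']
    ring_nf
  rw [hn, smul_smul, ← Real.rpow_mul hpos.le, ← Real.rpow_add hpos,
    mul_div_cancel₀ _ (by linarith)]
  simp

theorem hasGradientAt_log_normSq_add [CompleteSpace E] (a ε : ℝ) {y : E} (hy : y ≠ 0) :
    HasGradientAt (fun z : E => a * (Real.log (‖z‖ ^ 2) + ε * ‖z‖ ^ 2))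
      ((2 * a * ((‖y‖ ^ 2)⁻¹ + ε)) • y) y := by
  have hpos : 0 < ‖y‖ := norm_pos_iff.mpr hy
  have hsq := (hasFDerivAt_id (𝕜 := ℝ) y).norm_sq
  have h := ((hsq.log (by simpa using hy)).add (hsq.const_mul ε)).const_mul a
  rw [hasGradientAt_iff_hasFDerivAt]
  refine h.congr_fderiv ?_
  ext e
  simp
  ring

theorem hasFDerivAt_inv_normSq_add_smul (k ε : ℝ) {x : E} (hx : x ≠ 0) :
    HasFDerivAt (fun y : E => (k * ((‖y‖ ^ 2)⁻¹ + ε)) • y)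
      ((k * ((‖x‖ ^ 2)⁻¹ + ε)) • ContinuousLinearMap.id ℝ E
        - (2 * k / (‖x‖ ^ 2) ^ 2) • (innerSL ℝ x).smulRight x) x := by
  have hsq := (hasFDerivAt_id (𝕜 := ℝ) x).norm_sq
  have h0 : ‖x‖ ^ 2 ≠ 0 := by simpa using hx
  have hinv := (hasDerivAt_inv h0).comp_hasFDerivAt x hsq
  have h := ((hinv.add_const ε).const_mul k).smul (hasFDerivAt_id (𝕜 := ℝ) x)
  refine h.congr_fderiv ?_
  ext e
  simp [smul_smul, sub_eq_add_neg, ← neg_smul]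
  congr 1
  ring

end SecondOrder

section Comparison

variable {N : ℕ} {u : EuclideanSpace ℝ (Fin N) → ℝ}

/-- Expanded form of the `p`-Laplacian away from critical points. -/
theorem pLaplacian_eq_of_hasFDerivAt_gradient {p : ℝ} {x : EuclideanSpace ℝ (Fin N)}
    {H : EuclideanSpace ℝ (Fin N) →L[ℝ] EuclideanSpace ℝ (Fin N)}
    (hH : HasFDerivAt (gradient u) H x) (hx : gradient u x ≠ 0) :
    pLaplacian N p u x = ‖gradient u x‖ ^ (p - 2) *
      (∑ i, ⟪H (EuclideanSpace.basisFun (Fin N) ℝ i), EuclideanSpace.basisFun (Fin N) ℝ i⟫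
        + (p - 2) / ‖gradient u x‖ ^ 2 * ⟪H (gradient u x), gradient u x⟫) := by
  have hF : fderiv ℝ (pFlux N p u) x = _ := (hH.norm_rpow_smul_self hx (p - 2)).fderiv
  set ξ := gradient u x
  have hexpand : ⟪H ξ, ξ⟫ = ∑ i, ⟪H (EuclideanSpace.basisFun (Fin N) ℝ i), ξ⟫ *
      ⟪EuclideanSpace.basisFun (Fin N) ℝ i, ξ⟫ := by
    conv_lhs => rw [← (EuclideanSpace.basisFun (Fin N) ℝ).sum_repr' ξ]
    rw [map_sum, sum_inner]
    rw [(EuclideanSpace.basisFun (Fin N) ℝ).sum_repr' ξ]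
    simp only [map_smul, real_inner_smul_left, mul_comm]
  rw [pLaplacian, hF, hexpand, Finset.mul_sum, ← Finset.sum_add_distrib, Finset.mul_sum]
  refine Finset.sum_congr rfl fun i _ => ?_
  simp only [_root_.add_apply, _root_.smul_apply,
    ContinuousLinearMap.smulRight_apply, ContinuousLinearMap.comp_apply, innerSL_apply_apply,
    inner_add_left, real_inner_smul_left]
  rw [real_inner_comm (H _) ξ, real_inner_comm _ ξ]

theorem differentiableAt_gradient_of_pFlux {p : ℝ} (hp : 1 < p) {x : EuclideanSpace ℝ (Fin N)}
    (hF : DifferentiableAt ℝ (pFlux N p u) x) (hx : gradient u x ≠ 0) :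
    DifferentiableAt ℝ (gradient u) x := by
  have hne : pFlux N p u x ≠ 0 :=
    smul_ne_zero (Real.rpow_pos_of_pos (norm_pos_iff.mpr hx) _).ne' hx
  have h := hF.hasFDerivAt.norm_rpow_smul_self hne ((2 - p) / (p - 1))
  refine (h.congr_of_eventuallyEq (Eventually.of_forall fun y => ?_)).differentiableAt
  exact (norm_rpow_smul_norm_rpow_smul_self hp (gradient u y)).symm

/-- A function touched from below by the strictly `N`-subharmonic function
`a (log ‖x‖² + ε ‖x‖²)` has positive `N`-Laplacian at the contact point. -/
theorem pLaplacian_pos_of_isLocalMin_sub (hN : 2 ≤ N) {a ε : ℝ} (ha : 0 < a) (hε : 0 < ε)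
    {x : EuclideanSpace ℝ (Fin N)} (hx : x ≠ 0)
    (hu : ∀ᶠ y in nhds x, DifferentiableAt ℝ u y)
    (hF : DifferentiableAt ℝ (pFlux N N u) x)
    (hmin : IsLocalMin (fun y => u y - a * (Real.log (‖y‖ ^ 2) + ε * ‖y‖ ^ 2)) x) :
    0 < pLaplacian N N u x := by
  have hN' : (2 : ℝ) ≤ N := by exact_mod_cast hN
  have hxpos : 0 < ‖x‖ := norm_pos_iff.mpr hx
  set G : EuclideanSpace ℝ (Fin N) → EuclideanSpace ℝ (Fin N) :=
    fun y => (2 * a * ((‖y‖ ^ 2)⁻¹ + ε)) • y with hG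
  have hgrad : ∀ᶠ y in nhds x, HasGradientAt
      (fun y => u y - a * (Real.log (‖y‖ ^ 2) + ε * ‖y‖ ^ 2)) (gradient u y - G y) y := by
    filter_upwards [hu, isOpen_ne.mem_nhds hx] with y hy hy0
    have := hy.hasGradientAt.hasFDerivAt.sub (hasGradientAt_log_normSq_add a ε hy0).hasFDerivAt
    rw [hasGradientAt_iff_hasFDerivAt, map_sub]
    exact this
  have hξ : gradient u x = G x := by
    have h := hmin.hasFDerivAt_eq_zero hgrad.self_of_nhds.hasFDerivAt
    rw [map_eq_zero_iff _ (InnerProductSpace.toDual ℝ _).injective] at h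
    exact sub_eq_zero.mp h
  set k : ℝ := 2 * a * ((‖x‖ ^ 2)⁻¹ + ε) with hk
  have hkpos : 0 < k := by positivity
  have hξk : gradient u x = k • x := hξ
  have hξ0 : gradient u x ≠ 0 := by
    rw [hξk]
    exact smul_ne_zero hkpos.ne' hx
  have hH := (differentiableAt_gradient_of_pFlux (by linarith) hF hξ0).hasFDerivAt
  set H := fderiv ℝ (gradient u) x
  have hHG := hasFDerivAt_inv_normSq_add_smul (2 * a) ε hx
  have hle : ∀ e, k * ‖e‖ ^ 2 - 4 * a / (‖x‖ ^ 2) ^ 2 * ⟪x, e⟫ ^ 2 ≤ ⟪H e, e⟫ := by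
    intro e
    have h := inner_fderiv_nonneg_of_isLocalMin hmin hgrad (hH.sub hHG) e
    simp only [_root_.sub_apply, _root_.smul_apply,
      ContinuousLinearMap.smulRight_apply, innerSL_apply_apply, inner_sub_left,
      real_inner_smul_left, ContinuousLinearMap.id_apply, real_inner_self_eq_norm_sq] at h
    have : 2 * (2 * a) / (‖x‖ ^ 2) ^ 2 * (⟪x, e⟫ * ⟪x, e⟫)
        = 4 * a / (‖x‖ ^ 2) ^ 2 * ⟪x, e⟫ ^ 2 := by ring
    linarith
  have htrace : k * N - 4 * a / ‖x‖ ^ 2 ≤ ∑ i,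
      ⟪H (EuclideanSpace.basisFun (Fin N) ℝ i), EuclideanSpace.basisFun (Fin N) ℝ i⟫ := by
    refine le_trans (le_of_eq ?_) (Finset.sum_le_sum fun i _ =>
      hle (EuclideanSpace.basisFun (Fin N) ℝ i))
    have hsum := (EuclideanSpace.basisFun (Fin N) ℝ).sum_sq_inner_left x
    rw [Finset.sum_sub_distrib, ← Finset.mul_sum, ← Finset.mul_sum, hsum]
    simp only [OrthonormalBasis.norm_eq_one, Finset.sum_const, Finset.card_univ,
      Fintype.card_fin, nsmul_eq_mul]
    field_simp
  have hnormal : k - 4 * a / ‖x‖ ^ 2 ≤ ⟪H (gradient u x), gradient u x⟫ / ‖gradient u x‖ ^ 2 := by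
    rw [le_div_iff₀ (by positivity)]
    refine le_trans (le_of_eq ?_) (hle (gradient u x))
    rw [hξk, norm_smul, Real.norm_of_nonneg hkpos.le, real_inner_smul_right,
      real_inner_self_eq_norm_sq]
    field_simp
  rw [pLaplacian_eq_of_hasFDerivAt_gradient hH hξ0]
  refine mul_pos (Real.rpow_pos_of_pos (norm_pos_iff.mpr hξ0) _) ?_
  have hmul := mul_le_mul_of_nonneg_left hnormal (by linarith : (0 : ℝ) ≤ N - 2)
  have hkey : k * N - 4 * a / ‖x‖ ^ 2 + (N - 2) * (k - 4 * a / ‖x‖ ^ 2)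
      = (N - 1) * (4 * a * ε) := by
    rw [hk]
    ring
  have hpos : 0 < ((N : ℝ) - 1) * (4 * a * ε) := mul_pos (by linarith) (by positivity)
  have hassoc : ((N : ℝ) - 2) / ‖gradient u x‖ ^ 2 * ⟪H (gradient u x), gradient u x⟫
      = (N - 2) * (⟪H (gradient u x), gradient u x⟫ / ‖gradient u x‖ ^ 2) := by ring
  linarith

/-- Comparison with `a (log ‖x‖² + ε ‖x‖²)` on an annulus in the exterior of the unit ball. -/
theorem IsPSupersolution.le_of_le_on_spheres (hN : 2 ≤ N)
    (hu : IsPSupersolution N N u (fun _ => 0) {x | 1 < ‖x‖}) {a ε s R c : ℝ}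
    (ha : 0 < a) (hε : 0 < ε) (hs : 1 < s)
    (hbdry : ∀ x, ‖x‖ = s ∨ ‖x‖ = R → c ≤ u x - a * (Real.log (‖x‖ ^ 2) + ε * ‖x‖ ^ 2))
    {x : EuclideanSpace ℝ (Fin N)} (hsx : s ≤ ‖x‖) (hxR : ‖x‖ ≤ R) :
    c ≤ u x - a * (Real.log (‖x‖ ^ 2) + ε * ‖x‖ ^ 2) := by
  obtain ⟨hC1, hflux, hsup⟩ := hu
  have hopen : IsOpen {x : EuclideanSpace ℝ (Fin N) | 1 < ‖x‖} :=
    isOpen_lt continuous_const continuous_norm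
  set w : EuclideanSpace ℝ (Fin N) → ℝ :=
    fun y => u y - a * (Real.log (‖y‖ ^ 2) + ε * ‖y‖ ^ 2) with hw
  set K : Set (EuclideanSpace ℝ (Fin N)) := {y | s ≤ ‖y‖ ∧ ‖y‖ ≤ R} with hK
  have hKcpt : IsCompact K := by
    refine (isCompact_closedBall (0 : EuclideanSpace ℝ (Fin N)) R).of_isClosed_subset
      ((isClosed_le continuous_const continuous_norm).inter
        (isClosed_le continuous_norm continuous_const)) fun y hy => ?_
    simpa using hy.2
  have hcont : ContinuousOn w K := by
    refine (hC1.continuousOn.mono fun y hy => lt_of_lt_of_le hs hy.1).sub ?_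
    refine continuousOn_const.mul (ContinuousOn.add (ContinuousOn.log (by fun_prop) ?_)
      (by fun_prop))
    intro y hy
    have : 0 < ‖y‖ := by linarith [hy.1]
    positivity
  obtain ⟨z, hzK, hz⟩ := hKcpt.exists_isMinOn ⟨x, hsx, hxR⟩ hcont
  refine le_trans ?_ (hz ⟨hsx, hxR⟩)
  by_cases hzb : ‖z‖ = s ∨ ‖z‖ = R
  · exact hbdry z hzb
  exfalso
  push Not at hzb
  have hz1 : 1 < ‖z‖ := lt_of_lt_of_le hs hzK.1
  have hKnhds : K ∈ nhds z := by
    filter_upwards [(isOpen_lt continuous_const continuous_norm).mem_nhds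
        (lt_of_le_of_ne hzK.1 hzb.1.symm),
      (isOpen_lt continuous_norm continuous_const).mem_nhds (lt_of_le_of_ne hzK.2 hzb.2)]
      with y h1 h2 using ⟨le_of_lt h1, le_of_lt h2⟩
  have hlap := pLaplacian_pos_of_isLocalMin_sub hN ha hε
    (norm_pos_iff.mp (by linarith : 0 < ‖z‖))
    (eventually_of_mem (hopen.mem_nhds hz1) fun y hy =>
      (hC1.differentiableOn one_ne_zero).differentiableAt (hopen.mem_nhds hy))
    (hflux.differentiableAt (hopen.mem_nhds hz1)) (hz.isLocalMin hKnhds)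
  have := hsup z hz1
  simp only at this
  linarith

/-- The infimum of a nonnegative `N`-superharmonic function over dyadic annuli grows at most
logarithmically. -/
theorem IsPSupersolution.exists_sInf_annulus_le_log (hN : 2 ≤ N)
    (hu0 : ∀ x : EuclideanSpace ℝ (Fin N), 1 < ‖x‖ → 0 ≤ u x)
    (hu : IsPSupersolution N N u (fun _ => 0) {x | 1 < ‖x‖}) :
    ∃ C : ℝ, 0 < C ∧ ∀ r : ℝ, 2 ≤ r →
      sInf (u '' {x : EuclideanSpace ℝ (Fin N) | r < ‖x‖ ∧ ‖x‖ < 2 * r}) ≤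
        C * Real.log r := by
  set z : EuclideanSpace ℝ (Fin N) := EuclideanSpace.single ⟨0, by omega⟩ 2 with hzdef
  have hz : ‖z‖ = 2 := by simp [hzdef]
  have huz : 0 ≤ u z := hu0 z (by rw [hz]; norm_num)
  set κ : ℝ := Real.log (2 ^ 2) - Real.log ((3 / 2) ^ 2) with hκ
  have hκpos : 0 < κ := sub_pos.mpr (Real.log_lt_log (by norm_num) (by norm_num))
  refine ⟨6 * u z / κ + 1, by positivity, fun r hr => ?_⟩
  set m := sInf (u '' {x : EuclideanSpace ℝ (Fin N) | r < ‖x‖ ∧ ‖x‖ < 2 * r}) with hm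
  have hlog2 : 1 / 2 < Real.log r := by
    have := Real.log_le_log (by norm_num) hr
    linarith [Real.log_two_gt_d9]
  rcases le_or_gt m 0 with hm0 | hm0
  · exact hm0.trans (by positivity)
  have hbdd : BddBelow (u '' {x : EuclideanSpace ℝ (Fin N) | r < ‖x‖ ∧ ‖x‖ < 2 * r}) := by
    refine ⟨0, ?_⟩
    rintro _ ⟨x, hx, rfl⟩
    exact hu0 x (by linarith [hx.1])
  set R : ℝ := 3 / 2 * r with hR
  have hRpos : 0 < R := by positivity
  have hlogR : Real.log (R ^ 2) ≤ 4 * Real.log r := by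
    have h1 : R ^ 2 ≤ r ^ 4 := by
      have : R ≤ r ^ 2 := by nlinarith
      nlinarith
    simpa using Real.log_le_log (by positivity) h1
  have hlogR0 : 0 ≤ Real.log (R ^ 2) := Real.log_nonneg (by nlinarith)
  set a : ℝ := m / (Real.log (R ^ 2) + 1) with ha
  have hapos : 0 < a := by positivity
  have ham : a * (Real.log (R ^ 2) + 1) = m := by
    rw [ha]
    field_simp
  set c : ℝ := -(a * (Real.log ((3 / 2) ^ 2) + (R ^ 2)⁻¹ * (3 / 2) ^ 2)) with hc
  have hcneg : c ≤ 0 := by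
    have : 0 ≤ Real.log ((3 / 2 : ℝ) ^ 2) := Real.log_nonneg (by norm_num)
    rw [hc]
    exact neg_nonpos.mpr (by positivity)
  have hcomp := hu.le_of_le_on_spheres hN (a := a) (ε := (R ^ 2)⁻¹) (s := 3 / 2) (R := R)
    (c := c) hapos (by positivity) (by norm_num) ?_ (x := z) (by rw [hz]; norm_num)
    (by rw [hz, hR]; linarith)
  · rw [hz] at hcomp
    have haκ : a * κ ≤ u z := by
      have : 0 ≤ a * ((R ^ 2)⁻¹ * (2 ^ 2 - (3 / 2) ^ 2)) := by
        norm_num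
        positivity
      rw [hκ]
      rw [hc] at hcomp
      linarith
    have ha_le : a ≤ u z / κ := (le_div_iff₀ hκpos).mpr haκ
    have hfac : Real.log (R ^ 2) + 1 ≤ 6 * Real.log r := by linarith
    calc m = a * (Real.log (R ^ 2) + 1) := ham.symm
      _ ≤ u z / κ * (6 * Real.log r) := mul_le_mul ha_le hfac (by linarith) (by positivity)
      _ ≤ (6 * u z / κ + 1) * Real.log r := by
        have : u z / κ * (6 * Real.log r) = 6 * u z / κ * Real.log r := by ring
        linarith
  · rintro x (hx | hx)
    · rw [hx]
      have := hu0 x (by rw [hx]; norm_num)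
      linarith
    · have hux : m ≤ u x := csInf_le hbdd ⟨x, ⟨by rw [hx]; linarith, by rw [hx]; linarith⟩, rfl⟩
      rw [hx, inv_mul_cancel₀ (by positivity), ham]
      linarith

end Comparison

/-- If `N ≥ 2` and `u ≥ 0` is classically `N`-superharmonic on `{‖x‖ > 1}`, then
`ρ(r) = inf_{r < ‖x‖ < 2r} u(x)/log(3‖x‖)` is bounded above on `[2,∞)`; in particular
there is `C > 0` with `m(r) = inf_{r < ‖x‖ < 2r} u(x) ≤ C log r` for all `r ≥ 2`. -/
theorem rho_bounded_p_eq_N (N : ℕ) (hN : 2 ≤ N)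
    (u : EuclideanSpace ℝ (Fin N) → ℝ)
    (hu_nonneg : ∀ x : EuclideanSpace ℝ (Fin N), 1 < ‖x‖ → 0 ≤ u x)
    (hu_super : IsPSupersolution N (N : ℝ) u (fun _ => 0)
      {x : EuclideanSpace ℝ (Fin N) | 1 < ‖x‖}) :
    (∃ B : ℝ, ∀ r : ℝ, 2 ≤ r →
      sInf ((fun x : EuclideanSpace ℝ (Fin N) =>
          u x / Real.log (3 * ‖x‖)) '' {x | r < ‖x‖ ∧ ‖x‖ < 2 * r}) ≤ B) ∧
    (∃ C : ℝ, 0 < C ∧ ∀ r : ℝ, 2 ≤ r →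
      sInf (u '' {x : EuclideanSpace ℝ (Fin N) | r < ‖x‖ ∧ ‖x‖ < 2 * r}) ≤
        C * Real.log r) := by
  have hmain := hu_super.exists_sInf_annulus_le_log hN hu_nonneg
  refine ⟨?_, hmain⟩
  obtain ⟨C, -, hC⟩ := hmain
  refine ⟨C, fun r hr => ?_⟩
  have hlog : 0 < Real.log r := Real.log_pos (by linarith)
  refine le_of_mul_le_mul_right (le_trans ?_ (hC r hr)) hlog
  refine le_csInf (Set.Nonempty.image _
    ⟨EuclideanSpace.single ⟨0, by omega⟩ (3 / 2 * r), ?_⟩) ?_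
  · have : ‖3 / 2 * r‖ = 3 / 2 * r := Real.norm_of_nonneg (by positivity)
    simp only [Set.mem_ofPred_eq, PiLp.norm_single, this]
    constructor <;> linarith
  · rintro _ ⟨x, hx, rfl⟩
    have hux := hu_nonneg x (by linarith [hx.1])
    rw [← le_div_iff₀ hlog]
    refine le_trans (csInf_le ⟨0, ?_⟩ ⟨x, hx, rfl⟩) ?_
    · rintro _ ⟨y, hy, rfl⟩
      exact div_nonneg (hu_nonneg y (by linarith [hy.1]))
        (Real.log_nonneg (by linarith [hy.1]))
    · exact div_le_div_of_nonneg_left hux hlog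
        (Real.log_le_log (by linarith) (by linarith [hx.1]))
end
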